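/- Let V be an irreducible integrable module for the twisted full toroidal Lie algebra τ̃ of level zero having finite-dimensional weight spaces with respect to h̃. Then the highest weight space V₊ = {v ∈ V : τ̃₊·v = 0} is non-zero. -/

import Mathlib

open scoped BigOperators TensorProduct

noncomputable section

/-- Stage 1: a finite-dimensional simple complex Lie algebra `g` together with `n` commuting
automorphisms `σ i` of finite orders `m i`, fixed primitive roots of unity `ξ i`, and the
invariant nondegenerate symmetric bilinear form `bil`. -/
structure PreT where
  n : ℕ
  npos : 0 < n
  m : Fin n → ℕ
  mpos : ∀ i, 0 < m i
  g : Type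
  [gLR : LieRing g]
  [gLA : LieAlgebra ℂ g]
  gfin : FiniteDimensional ℂ g
  gsimple : LieAlgebra.IsSimple ℂ g
  σ : Fin n → (g ≃ₗ⁅ℂ⁆ g)
  σcomm : ∀ i j x, σ i (σ j x) = σ j (σ i x)
  σord : ∀ i x, (fun y => σ i y)^[m i] x = x
  ξ : Fin n → ℂ
  ξprim : ∀ i, IsPrimitiveRoot (ξ i) (m i)
  bil : g →ₗ[ℂ] g →ₗ[ℂ] ℂ
  bil_symm : ∀ x y, bil x y = bil y x
  bil_invariant : ∀ x y z, bil ⁅x, y⁆ z = bil x ⁅y, z⁆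
  bil_nondeg : ∀ x, (∀ y, bil x y = 0) → x = 0
  bil_aut : ∀ i x y, bil (σ i x) (σ i y) = bil x y

attribute [instance] PreT.gLR PreT.gLA

namespace PreT

variable (P : PreT)

/-- membership in the lattice `Γ = m₁ℤ ⊕ … ⊕ mₙℤ`. -/
def inΓ (r : Fin P.n → ℤ) : Prop := ∀ i, (P.m i : ℤ) ∣ r i

/-- the common eigenspace `𝔤_{k̄} = {x | σᵢ x = ξᵢ^{kᵢ} x}`. -/
def gr (k : Fin P.n → ℤ) : Submodule ℂ P.g :=
  ⨅ i, LinearMap.ker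
    ((P.σ i).toLinearEquiv.toLinearMap - P.ξ i ^ (k i) • (1 : Module.End ℂ P.g))

/-- Ĝ-characters: group homomorphisms `ℤⁿ/Γ → ℂˣ` presented as `Γ`-periodic functions. -/
def IsChar (χ : (Fin P.n → ℤ) → ℂ) : Prop :=
  (∀ k l, χ (k + l) = χ k * χ l) ∧ (∀ r, P.inΓ r → χ r = 1)

end PreT

/-- Stage 2: a Cartan subalgebra `h0 = 𝔥_{0̄}` of `𝔤_{0̄}` (abelian and self-normalizing
in `𝔤_{0̄}`). -/
structure Cartan (P : PreT) where
  h0 : Submodule ℂ P.g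
  h0_le : h0 ≤ P.gr 0
  h0_ne : h0 ≠ ⊥
  h0_abelian : ∀ x ∈ h0, ∀ y ∈ h0, ⁅x, y⁆ = 0
  h0_selfnorm : ∀ x ∈ P.gr 0, (∀ h ∈ h0, ⁅h, x⁆ ∈ h0) → x ∈ h0

namespace Cartan

variable {P : PreT} (C : Cartan P)

/-- the full weight space `{x ∈ 𝔤 | [h,x] = α(h)x ∀ h ∈ 𝔥_{0̄}}` of `𝔤` for `α ∈ 𝔥_{0̄}*`. -/
def wtfull (α : Module.Dual ℂ ↥C.h0) : Submodule ℂ P.g :=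
  ⨅ h : ↥C.h0, LinearMap.ker
    (LieAlgebra.ad ℂ P.g (h : P.g) - α h • (1 : Module.End ℂ P.g))

/-- the root space `𝔤_{k̄}(α)`. -/
def wtg (k : Fin P.n → ℤ) (α : Module.Dual ℂ ↥C.h0) : Submodule ℂ P.g :=
  P.gr k ⊓ C.wtfull α

/-- the set `Δ^× = Δ_{0,en}^×` of nonzero roots. -/
def Δen : Set (Module.Dual ℂ ↥C.h0) :=
  {α | α ≠ 0 ∧ ∃ k, C.wtg k α ≠ ⊥}

/-- weights for `h̃ = 𝔥_{0̄} ⊕ ⊕ᵢℂKᵢ ⊕ ⊕ᵢℂdᵢ`: a functional on `𝔥_{0̄}` together with the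
values on `K₁,…,Kₙ` and on `d₁,…,dₙ`. -/
abbrev Wt : Type := Module.Dual ℂ ↥C.h0 × (Fin P.n → ℂ) × (Fin P.n → ℂ)

/-- a real root `γ = α + δ_k` of `τ̃`, regarded as an element of `h̃*`. -/
def rootFn (α : Module.Dual ℂ ↥C.h0) (k : Fin P.n → ℤ) : C.Wt :=
  (α, 0, fun i => (k i : ℂ))

end Cartan

/-- Stage 3: the Lie-torus axioms together with a choice of a positive system and of coroots for
the (extended) root system `Δ_{0,en}`. -/
structure Torus (P : PreT) (C : Cartan P) where
  /-- `𝔤_{0̄}` is a (finite-dimensional) simple Lie algebra: no proper nonzero ideals … -/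
  g0_ideals : ∀ U : Submodule ℂ P.g, U ≤ P.gr 0 →
    (∀ x ∈ P.gr 0, ∀ u ∈ U, ⁅x, u⁆ ∈ U) → U = ⊥ ∨ U = P.gr 0
  /-- … and nonabelian. -/
  g0_nonabelian : ∃ x ∈ P.gr 0, ∃ y ∈ P.gr 0, ⁅x, y⁆ ≠ 0
  /-- condition (M): for `k̄ ≠ 0̄` with `𝔤_{k̄} ≠ 0`, `𝔤_{k̄} ≅ U ⊕ W` with `U` a trivial
  `𝔤_{0̄}`-module and `W` zero or irreducible of dimension `> 1` with weights in `Δ_{0,en}`. -/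
  cond_M : ∀ k : Fin P.n → ℤ, ¬ P.inΓ k → P.gr k ≠ ⊥ →
    ∃ U W : Submodule ℂ P.g, U ≤ P.gr k ∧ W ≤ P.gr k ∧ U ⊓ W = ⊥ ∧ U ⊔ W = P.gr k ∧
      (∀ x ∈ P.gr 0, ∀ u ∈ U, ⁅x, u⁆ = 0) ∧
      (W = ⊥ ∨
        ((∀ U' : Submodule ℂ P.g, U' ≤ W →
            (∀ x ∈ P.gr 0, ∀ u ∈ U', ⁅x, u⁆ ∈ U') → U' = ⊥ ∨ U' = W) ∧
          1 < Module.finrank ℂ ↥W ∧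
          W ≤ ⨆ α ∈ insert (0 : Module.Dual ℂ ↥C.h0) C.Δen, C.wtfull α))
  /-- condition (iii): the group generated by `σ₁,…,σₙ` has order `m₁ ⋯ mₙ`. -/
  ord_faithful : ∀ k : Fin P.n → ℤ,
    (∀ l, P.gr l ≠ ⊥ → (∏ i, P.ξ i ^ (k i * l i)) = 1) → P.inΓ k
  /-- a positive system for `Δ_{0,en}`. -/
  pos : Set (Module.Dual ℂ ↥C.h0)
  pos_sub : pos ⊆ C.Δen
  pos_total : ∀ α ∈ C.Δen, α ∈ pos ∨ -α ∈ pos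
  pos_disj : ∀ α ∈ pos, -α ∉ pos
  pos_add : ∀ α ∈ pos, ∀ β ∈ pos, α + β ∈ C.Δen → α + β ∈ pos
  /-- coroots `α∨ ∈ 𝔥_{0̄}`. -/
  coroot : Module.Dual ℂ ↥C.h0 → ↥C.h0
  coroot_two : ∀ α ∈ C.Δen, α (coroot α) = 2
  coroot_neg : ∀ α ∈ C.Δen, coroot (-α) = - coroot α
  /-- `cnorm α = 2/(α|α)`, characterized via the bilinear form. -/
  cnorm : Module.Dual ℂ ↥C.h0 → ℂ
  cnorm_spec : ∀ α ∈ C.Δen, ∀ h : ↥C.h0,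
    P.bil ((coroot α : P.g)) ((h : P.g)) = cnorm α * α h

namespace Torus

variable {P : PreT} {C : Cartan P} (T : Torus P C)

/-- evaluation `λ(γ∨)` of a weight `λ` at the coroot `γ∨ = α∨ + (2/(α|α)) Σᵢ kᵢKᵢ` of the real
root `γ = α + δ_k`. -/
def corootEval (α : Module.Dual ℂ ↥C.h0) (k : Fin P.n → ℤ) (w : C.Wt) : ℂ :=
  w.1 (T.coroot α) + T.cnorm α * ∑ i, (k i : ℂ) * w.2.1 i

/-- the reflection `r_γ(λ) = λ - λ(γ∨)γ` on `h̃*`. -/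
def reflFn (α : Module.Dual ℂ ↥C.h0) (k : Fin P.n → ℤ) : Function.End C.Wt :=
  fun w => w - T.corootEval α k w • C.rootFn α k

/-- the Weyl group `W` of `τ̃`, generated by the reflections in the real roots
(realized inside the monoid of self-maps of `h̃*`; as the generators are involutions this
coincides with the generated group). -/
def weyl : Submonoid (Function.End C.Wt) :=
  Submonoid.closure {f | ∃ α ∈ C.Δen, ∃ k, f = T.reflFn α k}

end Torus

/-- Stage 4: the twisted full toroidal Lie algebra
`τ̃ = LT ⊕ 𝒵(m) ⊕ 𝒟(m)`.  The elements `E k x` (for `x ∈ 𝔤_{k̄}`), `K r i` and `Dop r i`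
(for `r ∈ Γ`) realize `x ⊗ t^k`, `t^r Kᵢ` and `t^r dᵢ`, subject to the standard toroidal
bracket relations, with 2-cocycle `φ = c1 • φ₁ + c2 • φ₂`. -/
structure Toroidal (P : PreT) (C : Cartan P) (T : Torus P C) where
  τ : Type
  [τLR : LieRing τ]
  [τLA : LieAlgebra ℂ τ]
  E : (Fin P.n → ℤ) → P.g →ₗ[ℂ] τ
  K : (Fin P.n → ℤ) → Fin P.n → τ
  Dop : (Fin P.n → ℤ) → Fin P.n → τ
  c1 : ℂ
  c2 : ℂ
  K_not : ∀ r i, ¬ P.inΓ r → K r i = 0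
  Dop_not : ∀ r i, ¬ P.inΓ r → Dop r i = 0
  /-- the relation `Σᵢ rᵢ t^r Kᵢ = 0` coming from `dA(m)` in `𝒵(m) = Ω_{A(m)}/dA(m)`. -/
  K_dA : ∀ r, P.inΓ r → ∑ i, (r i : ℂ) • K r i = 0
  br_EE : ∀ k l x y, x ∈ P.gr k → y ∈ P.gr l →
    ⁅E k x, E l y⁆ = E (k + l) ⁅x, y⁆ + P.bil x y • ∑ i, (k i : ℂ) • K (k + l) i
  br_EK : ∀ k x, x ∈ P.gr k → ∀ r i, ⁅E k x, K r i⁆ = 0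
  br_KK : ∀ r s i j, ⁅K r i, K s j⁆ = 0
  br_DK : ∀ r s, P.inΓ r → P.inΓ s → ∀ i j,
    ⁅Dop r i, K s j⁆ = (s i : ℂ) • K (r + s) j +
      (if i = j then (1 : ℂ) else 0) • ∑ p, (r p : ℂ) • K (r + s) p
  br_DD : ∀ r s, P.inΓ r → P.inΓ s → ∀ i j,
    ⁅Dop r i, Dop s j⁆ = (s i : ℂ) • Dop (r + s) j - (r j : ℂ) • Dop (r + s) i +
      (c1 * (-(s i : ℂ) * (r j : ℂ)) + c2 * ((r i : ℂ) * (s j : ℂ))) •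
        ∑ p, (r p : ℂ) • K (r + s) p
  br_DE : ∀ r, P.inΓ r → ∀ i k x, x ∈ P.gr k → ⁅Dop r i, E k x⁆ = (k i : ℂ) • E (r + k) x
  span_top : Submodule.span ℂ
    ({t | ∃ k x, x ∈ P.gr k ∧ t = E k x} ∪ {t | ∃ r i, P.inΓ r ∧ t = K r i} ∪
      {t | ∃ r i, P.inΓ r ∧ t = Dop r i}) = ⊤
  E_inj : ∀ k x, x ∈ P.gr k → E k x = 0 → x = 0

attribute [instance] Toroidal.τLR Toroidal.τLA

namespace Toroidal

variable {P : PreT} {C : Cartan P} {T : Torus P C} (X : Toroidal P C T)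

/-- the generators `𝔤_{k̄}(α) ⊗ ℂt^k`, `α` positive, of `τ̃₊`. -/
def tauP : Set X.τ :=
  {t | ∃ α ∈ T.pos, ∃ k x, x ∈ C.wtg k α ∧ t = X.E k x}

/-- the generators `𝔤_{k̄}(α) ⊗ ℂt^k`, `α` negative, of `τ̃₋`. -/
def tauM : Set X.τ :=
  {t | ∃ α, -α ∈ T.pos ∧ ∃ k x, x ∈ C.wtg k α ∧ t = X.E k x}

/-- the generators `𝔤_{k̄}(0) ⊗ ℂt^k`, `t^rKᵢ`, `t^rdᵢ` of `τ̃₀`. -/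
def tauZ : Set X.τ :=
  {t | (∃ k x, x ∈ C.wtg k 0 ∧ t = X.E k x) ∨
    (∃ r i, P.inΓ r ∧ (t = X.K r i ∨ t = X.Dop r i))}

/-- the generators of `τ̂ = LT ⊕ 𝒟(m)`. -/
def tauHat : Set X.τ :=
  {t | (∃ k x, x ∈ P.gr k ∧ t = X.E k x) ∨ (∃ r i, P.inΓ r ∧ t = X.Dop r i)}

/-- the element `I(u,r) = D(u,r) - D(u,0) = Σᵢ uᵢ t^r dᵢ - Σᵢ uᵢ dᵢ`. -/
def Iop (u : Fin P.n → ℂ) (r : Fin P.n → ℤ) : X.τ :=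
  ∑ i, u i • X.Dop r i - ∑ i, u i • X.Dop 0 i

/-- generators of `L̃ = I ⋉ L(g̊,σ)`, where `g̊` is the centralizer of `𝔥_{0̄}` in `𝔤`. -/
def Ltil : Set X.τ :=
  {t | (∃ u r, P.inΓ r ∧ t = X.Iop u r) ∨
    (∃ k x, x ∈ P.gr k ∧ x ∈ C.wtfull 0 ∧ t = X.E k x)}

/-- generators of `I ⋉ (𝔥_{0̄} ⊗ A(m))`. -/
def IhGen : Set X.τ :=
  {t | (∃ u r, P.inΓ r ∧ t = X.Iop u r) ∨
    (∃ r h, P.inΓ r ∧ h ∈ C.h0 ∧ h ∈ P.gr r ∧ h ∈ C.wtfull 0 ∧ t = X.E r h)}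

end Toroidal

/-- a representation of `τ̃` on a complex vector space. -/
structure TRep {P : PreT} {C : Cartan P} {T : Torus P C} (X : Toroidal P C T) where
  V : Type
  [Vadd : AddCommGroup V]
  [Vmod : Module ℂ V]
  ρ : X.τ →ₗ[ℂ] Module.End ℂ V
  ρ_lie : ∀ a b : X.τ, ρ ⁅a, b⁆ = ρ a * ρ b - ρ b * ρ a

attribute [instance] TRep.Vadd TRep.Vmod

namespace TRep

variable {P : PreT} {C : Cartan P} {T : Torus P C} {X : Toroidal P C T} (M : TRep X)

/-- the weight space `V_w` with respect to `h̃`. -/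
def wtSp (w : C.Wt) : Submodule ℂ M.V :=
  (⨅ h : ↥C.h0, LinearMap.ker (M.ρ (X.E 0 (h : P.g)) - w.1 h • (1 : Module.End ℂ M.V))) ⊓
  (⨅ i, LinearMap.ker (M.ρ (X.K 0 i) - w.2.1 i • (1 : Module.End ℂ M.V))) ⊓
  (⨅ i, LinearMap.ker (M.ρ (X.Dop 0 i) - w.2.2 i • (1 : Module.End ℂ M.V)))

/-- the set `P(V)` of weights of `V`. -/
def wts : Set C.Wt := {w | M.wtSp w ≠ ⊥}

/-- `V` is a weight module: `V = ⊕_{λ ∈ h̃*} V_λ`. -/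
def IsWeight : Prop := (⨆ w : C.Wt, M.wtSp w) = ⊤

/-- `V` has finite-dimensional weight spaces. -/
def FinWt : Prop := ∀ w : C.Wt, FiniteDimensional ℂ ↥(M.wtSp w)

/-- integrability: `V` is a weight module on which all the root vectors
`x ∈ 𝔤_{k̄}(α) ⊗ ℂt^k`, `α ≠ 0`, act locally nilpotently. -/
def Integrable : Prop :=
  M.IsWeight ∧ ∀ (k : Fin P.n → ℤ) (α : Module.Dual ℂ ↥C.h0), α ≠ 0 →
    ∀ x ∈ C.wtg k α, ∀ v : M.V, ∃ N : ℕ, (M.ρ (X.E k x) ^ N) v = 0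

/-- level zero: the central elements `K₁, …, Kₙ` act trivially. -/
def LevelZero : Prop := ∀ i, M.ρ (X.K 0 i) = 0

/-- irreducibility of `V` over `τ̃`. -/
def Irr : Prop :=
  Nontrivial M.V ∧
    ∀ U : Submodule ℂ M.V, (∀ t : X.τ, ∀ v ∈ U, M.ρ t v ∈ U) → U = ⊥ ∨ U = ⊤

/-- the Lie torus `LT` acts non-trivially on `V`. -/
def LTnontrivial : Prop := ∃ k x, x ∈ P.gr k ∧ M.ρ (X.E k x) ≠ 0

/-- the highest weight space `V₊ = {v ∈ V | τ̃₊ ⬝ v = 0}`. -/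
def Vplus : Submodule ℂ M.V := ⨅ t ∈ X.tauP, LinearMap.ker (M.ρ t)

/-- `U(τ̃₀)v`: the smallest subspace of `V` containing `v` and invariant under `τ̃₀`. -/
def u0span (v : M.V) : Submodule ℂ M.V :=
  sInf {U | v ∈ U ∧ ∀ t ∈ X.tauZ, ∀ u ∈ U, M.ρ t u ∈ U}

/-- `V` is a level zero highest weight module for `τ̃` (Definition 3.3). -/
def IsHW : Prop :=
  ∃ v : M.V, v ≠ 0 ∧ (∃ w : C.Wt, v ∈ M.wtSp w) ∧
    (∀ U : Submodule ℂ M.V, (∀ t : X.τ, ∀ u ∈ U, M.ρ t u ∈ U) → v ∈ U → U = ⊤) ∧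
    (∀ t ∈ X.tauP, M.ρ t v = 0) ∧
    (∀ U : Submodule ℂ M.V, U ≤ M.u0span v →
      (∀ t ∈ X.tauZ, ∀ u ∈ U, M.ρ t u ∈ U) → U = ⊥ ∨ U = M.u0span v) ∧
    (∀ i, M.ρ (X.K 0 i) = 0)

/-- simultaneous eigenspace for the degree derivations `d₁,…,dₙ`. -/
def dEig (b : Fin P.n → ℂ) : Submodule ℂ M.V :=
  ⨅ i, LinearMap.ker (M.ρ (X.Dop 0 i) - b i • (1 : Module.End ℂ M.V))

/-- the graded piece `V₊(k) = {v ∈ V₊ | dᵢ v = (Λ(dᵢ)+kᵢ) v}`. -/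
def VplusGr (Λ : C.Wt) (k : Fin P.n → ℤ) : Submodule ℂ M.V :=
  M.Vplus ⊓ M.dEig (fun i => Λ.2.2 i + (k i : ℂ))

/-- `𝒵(m)` acts trivially on `V`. -/
def Ztrivial : Prop := ∀ r, P.inΓ r → ∀ i, M.ρ (X.K r i) = 0

end TRep

/-- isomorphism of representations of `τ̃`. -/
def TRepIso {P : PreT} {C : Cartan P} {T : Torus P C} {X : Toroidal P C T}
    (M N : TRep X) : Prop :=
  ∃ e : M.V ≃ₗ[ℂ] N.V, ∀ t v, e (M.ρ t v) = N.ρ t (e v)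

/-- Operators satisfying the `sl₂` relations, the two root vectors being nilpotent on every
eigenvector of the semisimple element. -/
structure NilpotentSl2 {V : Type*} [AddCommGroup V] [Module ℂ V] (e f h : Module.End ℂ V) :
    Prop where
  he : ∀ v, h (e v) = e (h v) + (2 : ℂ) • e v
  hf : ∀ v, h (f v) = f (h v) - (2 : ℂ) • f v
  ef : ∀ v, e (f v) = f (e v) + h v
  nil_e : ∀ (c : ℂ) v, h v = c • v → ∃ N : ℕ, (e ^ N) v = 0
  nil_f : ∀ (c : ℂ) v, h v = c • v → ∃ N : ℕ, (f ^ N) v = 0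

namespace NilpotentSl2

variable {V : Type*} [AddCommGroup V] [Module ℂ V] {e f h : Module.End ℂ V}

/-- Exchanging the roles of the two root vectors. -/
theorem swap (S : NilpotentSl2 e f h) : NilpotentSl2 f e (-h) where
  he v := by simp [S.hf v]; abel
  hf v := by simp [S.he v]; abel
  ef v := by simp [S.ef v]
  nil_e c v hv := S.nil_f (-c) v (by simpa [neg_eq_iff_eq_neg] using hv)
  nil_f c v hv := S.nil_e (-c) v (by simpa [neg_eq_iff_eq_neg] using hv)

theorem h_apply_e_pow (S : NilpotentSl2 e f h) {c : ℂ} {v : V} (hv : h v = c • v) (n : ℕ) :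
    h ((e ^ n) v) = (c + 2 * n) • (e ^ n) v := by
  induction n with
  | zero => simpa using hv
  | succ n ih =>
    rw [pow_succ', Module.End.mul_apply, S.he, ih, map_smul, ← add_smul]
    push_cast
    ring_nf

theorem h_apply_f_pow (S : NilpotentSl2 e f h) {c : ℂ} {v : V} (hv : h v = c • v) (n : ℕ) :
    h ((f ^ n) v) = (c - 2 * n) • (f ^ n) v := by
  have := S.swap.h_apply_e_pow (c := -c) (v := v) (by simp [hv]) n
  rw [LinearMap.neg_apply, neg_eq_iff_eq_neg, ← neg_smul] at this
  rw [this]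
  ring_nf

theorem e_apply_f_pow (S : NilpotentSl2 e f h) {c : ℂ} {v : V} (hv : h v = c • v) (n : ℕ) :
    e ((f ^ (n + 1)) v) = (f ^ (n + 1)) (e v) + ((n + 1) * (c - n)) • (f ^ n) v := by
  induction n with
  | zero => simp [S.ef, hv]
  | succ n ih =>
    have hf : ∀ (k : ℕ) (u : V), f ((f ^ k) u) = (f ^ (k + 1)) u := fun k u => by
      rw [pow_succ', Module.End.mul_apply]
    rw [← hf, S.ef, ih, S.h_apply_f_pow hv, map_add, map_smul, hf, hf, add_assoc, ← add_smul]
    push_cast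
    ring_nf

theorem exists_nat_of_primitive (S : NilpotentSl2 e f h) {c : ℂ} {v : V} (hv : h v = c • v)
    (hv0 : v ≠ 0) (hev : e v = 0) : ∃ p : ℕ, c = p := by
  classical
  have hN := S.nil_f c v hv
  obtain ⟨n, hn⟩ : ∃ n, Nat.find hN = n + 1 := by
    refine Nat.exists_eq_succ_of_ne_zero fun h0 => hv0 ?_
    simpa [h0] using Nat.find_spec hN
  have h1 : (f ^ (n + 1)) v = 0 := hn ▸ Nat.find_spec hN
  have h2 : (f ^ n) v ≠ 0 := Nat.find_min hN (by omega)
  have h3 := S.e_apply_f_pow hv n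
  rw [h1, hev, map_zero, map_zero, zero_add, eq_comm, smul_eq_zero] at h3
  have h4 : (n + 1 : ℂ) ≠ 0 := by exact_mod_cast n.succ_ne_zero
  refine ⟨n, ?_⟩
  simpa [h4, h2, sub_eq_zero] using h3

theorem f_pow_eq_zero_of_primitive (S : NilpotentSl2 e f h) {p : ℕ} {v : V}
    (hv : h v = (p : ℂ) • v) (hev : e v = 0) : (f ^ (p + 1)) v = 0 := by
  by_contra hne
  obtain ⟨q, hq⟩ := S.exists_nat_of_primitive (S.h_apply_f_pow hv (p + 1)) hne
    (by rw [S.e_apply_f_pow hv, hev]; simp)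
  have : ((p + q + 2 : ℕ) : ℂ) = 0 := by
    push_cast at hq ⊢
    linear_combination -hq
  exact absurd this (Nat.cast_ne_zero.2 (by omega))

theorem f_pow_ne_zero_of_primitive (S : NilpotentSl2 e f h) {p : ℕ} {v : V}
    (hv : h v = (p : ℂ) • v) (hv0 : v ≠ 0) (hev : e v = 0) {j : ℕ} (hj : j ≤ p) :
    (f ^ j) v ≠ 0 := by
  induction j with
  | zero => simpa using hv0
  | succ j ih =>
    intro h0
    have h1 := S.e_apply_f_pow hv j
    rw [h0, hev, map_zero, map_zero, zero_add, eq_comm, smul_eq_zero] at h1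
    have h4 : (j + 1 : ℂ) ≠ 0 := by exact_mod_cast j.succ_ne_zero
    have h5 : (p - j : ℂ) ≠ 0 := by
      rw [sub_ne_zero]
      exact_mod_cast (by omega : p ≠ j)
    exact h1.elim (mul_ne_zero h4 h5) (ih (by omega))

/-- The power `f ^ m` is injective on the `m`-eigenspace of `h`. -/
theorem f_pow_ne_zero (S : NilpotentSl2 e f h) {m : ℕ} {v : V}
    (hv : h v = (m : ℂ) • v) (hv0 : v ≠ 0) : (f ^ m) v ≠ 0 := by
  obtain ⟨N, hN⟩ := S.nil_e m v hv
  induction N generalizing m v with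
  | zero => exact absurd (by simpa using hN) hv0
  | succ N ih =>
    intro h0
    by_cases hev : e v = 0
    · exact S.f_pow_ne_zero_of_primitive hv hv0 hev le_rfl h0
    have h1 : h (e v) = ((m + 2 : ℕ) : ℂ) • e v := by
      rw [S.he, hv, map_smul, ← add_smul]
      push_cast
      rfl
    refine ih h1 hev (by rwa [pow_succ, Module.End.mul_apply] at hN) ?_
    have h2 := S.e_apply_f_pow hv m
    rw [pow_succ', Module.End.mul_apply, h0] at h2
    have h3 : (f ^ (m + 1)) (e v) = 0 := by simpa [h0, pow_succ'] using h2.symm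
    rw [pow_succ', Module.End.mul_apply, h3, map_zero]

theorem exists_int (S : NilpotentSl2 e f h) {c : ℂ} {v : V} (hv : h v = c • v)
    (hv0 : v ≠ 0) : ∃ z : ℤ, c = z := by
  classical
  have hN := S.nil_e c v hv
  obtain ⟨n, hn⟩ : ∃ n, Nat.find hN = n + 1 := by
    refine Nat.exists_eq_succ_of_ne_zero fun h0 => hv0 ?_
    simpa [h0] using Nat.find_spec hN
  have h1 : (e ^ (n + 1)) v = 0 := hn ▸ Nat.find_spec hN
  have h2 : (e ^ n) v ≠ 0 := Nat.find_min hN (by omega)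
  obtain ⟨p, hp⟩ := S.exists_nat_of_primitive (S.h_apply_e_pow hv n) h2
    (by rwa [pow_succ', Module.End.mul_apply] at h1)
  exact ⟨p - 2 * n, by push_cast; linear_combination hp⟩

theorem e_apply_ne_zero (S : NilpotentSl2 e f h) {z : ℤ} {v : V} (hv : h v = (z : ℂ) • v)
    (hv0 : v ≠ 0) (hz : z < 0) : e v ≠ 0 := by
  intro hev
  obtain ⟨p, hp⟩ := S.exists_nat_of_primitive hv hv0 hev
  have : z = p := by exact_mod_cast hp
  omega

theorem e_f_apply_ne_zero (S : NilpotentSl2 e f h) {m : ℕ} (hm : 0 < m) {v : V}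
    (hv : h v = (m : ℂ) • v) (hv0 : v ≠ 0) : e (f v) ≠ 0 := by
  intro h0
  refine S.f_pow_ne_zero hv hv0 ?_
  obtain ⟨m, rfl⟩ := Nat.exists_eq_succ_of_ne_zero hm.ne'
  rw [Nat.succ_eq_add_one, pow_succ, Module.End.mul_apply]
  have h1 := S.h_apply_f_pow hv 1
  rw [pow_one] at h1
  by_cases hfv : f v = 0
  · rw [hfv, map_zero]
  obtain ⟨p, hp⟩ := S.exists_nat_of_primitive h1 hfv h0
  have hm : m = p + 1 := by
    have : (m : ℂ) = (p + 1 : ℕ) := by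
      push_cast at hp ⊢
      linear_combination hp
    exact_mod_cast this
  rw [hp] at h1
  rw [hm]
  exact S.f_pow_eq_zero_of_primitive h1 h0

end NilpotentSl2

section LocallyFinite

variable {V : Type*} [AddCommGroup V] [Module ℂ V]

/-- An endomorphism is locally finite if finite-dimensional subspaces are contained in invariant
finite-dimensional subspaces. -/
def IsLocallyFinite (x : Module.End ℂ V) : Prop :=
  ∀ S : Submodule ℂ V, S.FG → ∃ S' : Submodule ℂ V, S'.FG ∧ S ≤ S' ∧ ∀ v ∈ S', x v ∈ S'

theorem isLocallyFinite_of_forall {x : Module.End ℂ V}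
    (hx : ∀ v, ∃ S : Submodule ℂ V, S.FG ∧ v ∈ S ∧ ∀ u ∈ S, x u ∈ S) : IsLocallyFinite x := by
  intro S hS
  induction S, hS using Submodule.fg_induction with
  | singleton v =>
    obtain ⟨S', h1, h2, h3⟩ := hx v
    exact ⟨S', h1, by simpa using h2, h3⟩
  | sup S₁ S₂ _ _ h₁ h₂ =>
    obtain ⟨A, a1, a2, a3⟩ := h₁
    obtain ⟨B, b1, b2, b3⟩ := h₂
    refine ⟨A ⊔ B, a1.sup b1, sup_le_sup a2 b2, fun v hv => ?_⟩
    obtain ⟨a, ha, b, hb, rfl⟩ := Submodule.mem_sup.1 hv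
    rw [map_add]
    exact add_mem (Submodule.mem_sup_left (a3 a ha)) (Submodule.mem_sup_right (b3 b hb))

theorem isLocallyFinite_of_nilpotent {x : Module.End ℂ V}
    (hx : ∀ v, ∃ N : ℕ, (x ^ N) v = 0) : IsLocallyFinite x := by
  refine isLocallyFinite_of_forall fun v => ?_
  obtain ⟨N, hN⟩ := hx v
  have hge : ∀ j, N ≤ j → (x ^ j) v = 0 := fun j hj => by
    obtain ⟨i, rfl⟩ := Nat.exists_eq_add_of_le' hj
    rw [pow_add, Module.End.mul_apply, hN, map_zero]
  refine ⟨Submodule.span ℂ ((fun i => (x ^ i) v) '' Set.Iic N),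
    Submodule.fg_span ((Set.finite_Iic N).image _),
    Submodule.subset_span ⟨0, by simp, by simp⟩, fun u hu => ?_⟩
  induction hu using Submodule.span_induction with
  | mem u hu =>
    obtain ⟨i, hi, rfl⟩ := hu
    simp only
    rw [← Module.End.mul_apply, ← pow_succ']
    rcases Nat.lt_or_ge i N with hiN | hiN
    · exact Submodule.subset_span ⟨i + 1, hiN, rfl⟩
    · rw [hge _ (by omega)]
      exact zero_mem _
  | zero => simp
  | add a b _ _ ha hb => rw [map_add]; exact add_mem ha hb
  | smul c a _ ha => rw [map_smul]; exact Submodule.smul_mem _ _ ha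

theorem isLocallyFinite_of_iSup_eigenspace {x : Module.End ℂ V}
    (hx : ⨆ c, x.eigenspace c = ⊤) : IsLocallyFinite x := by
  refine isLocallyFinite_of_forall fun v => ?_
  have hv : v ∈ ⨆ c, x.eigenspace c := hx ▸ Submodule.mem_top
  induction hv using Submodule.iSup_induction' with
  | mem c v hv =>
    refine ⟨ℂ ∙ v, Submodule.fg_span_singleton v, Submodule.mem_span_singleton_self v,
      fun u hu => ?_⟩
    obtain ⟨b, rfl⟩ := Submodule.mem_span_singleton.1 hu
    rw [map_smul, Module.End.mem_eigenspace_iff.1 hv]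
    exact Submodule.smul_mem _ _ (Submodule.smul_mem _ _ (Submodule.mem_span_singleton_self v))
  | zero => exact ⟨⊥, Submodule.fg_bot, by simp, by simp⟩
  | add a b _ _ ha hb =>
    obtain ⟨A, a1, a2, a3⟩ := ha
    obtain ⟨B, b1, b2, b3⟩ := hb
    refine ⟨A ⊔ B, a1.sup b1,
      add_mem (Submodule.mem_sup_left a2) (Submodule.mem_sup_right b2), fun v hv => ?_⟩
    obtain ⟨a, ha, b, hb, rfl⟩ := Submodule.mem_sup.1 hv
    rw [map_add]
    exact add_mem (Submodule.mem_sup_left (a3 a ha)) (Submodule.mem_sup_right (b3 b hb))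

/-- If `L` is a space of operators which is closed under commutators, permuting the factors of a
product of elements of `L` changes it by products with fewer factors. -/
theorem prod_sub_prod_mem_pow {A : Type*} [Ring A] [Algebra ℂ A] {L : Submodule ℂ A}
    (hL : ∀ x ∈ L, ∀ y ∈ L, x * y - y * x ∈ L) {l l' : List A} (h : l.Perm l')
    (hl : ∀ x ∈ l, x ∈ L) : l.prod - l'.prod ∈ (1 ⊔ L) ^ (l.length - 1) := by
  have hpow : ∀ l : List A, (∀ x ∈ l, x ∈ L) → l.prod ∈ (1 ⊔ L) ^ l.length := by
    intro l
    induction l with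
    | nil => intro _; simpa using ⟨1, map_one _⟩
    | cons x l ih =>
      intro hl
      rw [List.prod_cons, List.length_cons, pow_succ']
      exact Submodule.mul_mem_mul (Submodule.mem_sup_right (hl x (by simp)))
        (ih fun y hy => hl y (by simp [hy]))
  induction h with
  | nil => simp
  | @cons x l₁ l₂ h12 ih =>
    rw [List.prod_cons, List.prod_cons, ← mul_sub]
    rcases l₁ with _ | ⟨y, l₁⟩
    · rw [List.nil_perm] at h12
      simp [h12]
    · simp only [List.length_cons, Nat.add_sub_cancel] at ih ⊢
      rw [pow_succ']
      exact Submodule.mul_mem_mul (Submodule.mem_sup_right (hl x (by simp)))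
        (ih fun z hz => hl z (by simp [List.mem_cons.1 hz]))
  | swap x y l =>
    have : (y :: x :: l).prod - (x :: y :: l).prod = (y * x - x * y) * l.prod := by
      simp only [List.prod_cons]; noncomm_ring
    rw [this]
    simp only [List.length_cons, Nat.add_sub_cancel]
    rw [pow_succ']
    exact Submodule.mul_mem_mul
      (Submodule.mem_sup_right (hL _ (hl y (by simp)) _ (hl x (by simp))))
      (hpow _ fun z hz => hl z (by simp [hz]))
  | @trans l₁ l₂ l₃ h12 h23 ih1 ih2 =>
    rw [← sub_add_sub_cancel _ l₂.prod]
    refine add_mem (ih1 hl) ?_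
    rw [h12.length_eq]
    exact ih2 fun x hx => hl x (h12.mem_iff.2 hx)

theorem pow_le_span_prod {A : Type*} [Ring A] [Algebra ℂ A] (s : Set A) (n : ℕ) :
    (1 ⊔ Submodule.span ℂ s) ^ n ≤
      Submodule.span ℂ {a | ∃ l : List A, (∀ x ∈ l, x ∈ s) ∧ l.length ≤ n ∧ a = l.prod} := by
  induction n with
  | zero =>
    rw [pow_zero, Submodule.one_eq_span]
    exact Submodule.span_mono (by rintro _ rfl; exact ⟨[], by simp⟩)
  | succ n ih =>
    rw [pow_succ']
    refine (mul_le_mul_right ih _).trans ?_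
    rw [Submodule.one_eq_span, ← Submodule.span_union, Submodule.span_mul_span]
    refine Submodule.span_mono ?_
    rintro _ ⟨x, hx, _, ⟨l, hl, hn, rfl⟩, rfl⟩
    rcases hx with rfl | hx
    · exact ⟨l, hl, by omega, by simp⟩
    · exact ⟨x :: l, by simpa using ⟨hx, hl⟩, by simpa using hn, by simp⟩

/-- An operator in a product of lists can be moved to the front. -/
theorem exists_perm_prod_mem {l : List (Module.End ℂ V)} (hl : ∀ x ∈ l, IsLocallyFinite x)
    {S : Submodule ℂ V} (hS : S.FG) :
    ∃ T : Submodule ℂ V, T.FG ∧ S ≤ T ∧ ∀ w : List (Module.End ℂ V), (∀ x ∈ w, x ∈ l) →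
      ∃ w' : List (Module.End ℂ V), w.Perm w' ∧ ∀ v ∈ S, w'.prod v ∈ T := by
  classical
  induction l with
  | nil =>
    refine ⟨S, hS, le_rfl, fun w hw => ⟨w, .refl _, fun v hv => ?_⟩⟩
    rw [List.eq_nil_iff_forall_not_mem.2 fun x hx => List.not_mem_nil (hw x hx)]
    simpa using hv
  | cons x l ih =>
    obtain ⟨T, hT, hST, hT'⟩ := ih fun y hy => hl y (by simp [hy])
    obtain ⟨T₁, hT₁, hTT, hx⟩ := hl x (by simp) T hT
    refine ⟨T₁, hT₁, hST.trans hTT, fun w hw => ?_⟩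
    obtain ⟨w', hw', hmem⟩ := hT' (w.filter fun y => !decide (y = x)) fun y hy => by
      rw [List.mem_filter] at hy
      have := hw y hy.1
      simp_all
    refine ⟨w.filter (fun y => decide (y = x)) ++ w',
      (List.filter_append_perm _ w).symm.trans (List.Perm.append_left _ hw'), fun v hv => ?_⟩
    rw [List.prod_append, Module.End.mul_apply, List.filter_eq, List.prod_replicate]
    have := hTT (hmem v hv)
    generalize w'.prod v = u at this
    generalize List.count x w = k
    induction k with
    | zero => simpa
    | succ k ihk => rw [pow_succ', Module.End.mul_apply]; exact hx _ ihk

/-- A finite-dimensional Lie algebra of operators which is spanned by locally finite operators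
is itself locally finite. -/
theorem exists_fg_invariant {s : Set (Module.End ℂ V)} (hs : s.Finite)
    (hlf : ∀ x ∈ s, IsLocallyFinite x)
    (hL : ∀ x ∈ Submodule.span ℂ s, ∀ y ∈ Submodule.span ℂ s, x * y - y * x ∈ Submodule.span ℂ s)
    {S : Submodule ℂ V} (hS : S.FG) :
    ∃ S' : Submodule ℂ V, S'.FG ∧ S ≤ S' ∧ ∀ x ∈ Submodule.span ℂ s, ∀ v ∈ S', x v ∈ S' := by
  obtain ⟨T, hT, hST, hT'⟩ := exists_perm_prod_mem (l := hs.toFinset.toList)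
    (fun x hx => hlf x (by simpa using hx)) hS
  set L := Submodule.span ℂ s with hLdef
  have key : ∀ n, ∀ a ∈ (1 ⊔ L) ^ n, ∀ v ∈ S, a v ∈ T := by
    intro n
    induction n using Nat.strong_induction_on with | _ n ih => ?_
    intro a ha v hv
    have ha' := pow_le_span_prod s n ha
    clear ha
    induction ha' using Submodule.span_induction with
    | mem a ha =>
      obtain ⟨w, hw, hn, rfl⟩ := ha
      rcases List.eq_nil_or_concat w with rfl | ⟨w₁, x, rfl⟩
      · simpa using hST hv
      set w := w₁.concat x with hwdef
      have hlen : 0 < w.length := by simp [hwdef]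
      obtain ⟨w', hww, hw'⟩ := hT' w fun x hx => by simpa using hw x hx
      have h1 := prod_sub_prod_mem_pow hL hww fun x hx => Submodule.subset_span (hw x hx)
      have h2 := ih _ (by omega) _ h1 v hv
      rw [LinearMap.sub_apply] at h2
      simpa using add_mem h2 (hw' v hv)
    | zero => simp
    | add a b _ _ ha hb => rw [LinearMap.add_apply]; exact add_mem ha hb
    | smul c a _ ha => rw [LinearMap.smul_apply]; exact T.smul_mem _ ha
  let G : Set V := {u | ∃ n, ∃ a ∈ (1 ⊔ L) ^ n, ∃ v ∈ S, u = a v}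
  refine ⟨Submodule.span ℂ G, ?_, fun v hv => Submodule.subset_span
    ⟨0, 1, by simpa using ⟨1, map_one _⟩, v, hv, by simp⟩, fun x hx v hv => ?_⟩
  · refine Submodule.FG.of_le hT (Submodule.span_le.2 ?_)
    rintro _ ⟨n, a, ha, v, hv, rfl⟩
    exact key n a ha v hv
  · induction hv using Submodule.span_induction with
    | mem u hu =>
      obtain ⟨n, a, ha, v, hv, rfl⟩ := hu
      refine Submodule.subset_span ⟨n + 1, x * a, ?_, v, hv, by simp⟩
      rw [pow_succ']
      exact Submodule.mul_mem_mul (Submodule.mem_sup_right hx) ha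
    | zero => simp
    | add a b _ _ ha hb => rw [map_add]; exact add_mem ha hb
    | smul c a _ ha => rw [map_smul]; exact Submodule.smul_mem _ _ ha

end LocallyFinite

theorem maxGenEigenspace_eq_of_iSup_eigenspace {V : Type*} [AddCommGroup V] [Module ℂ V]
    {f : Module.End ℂ V} (hf : ⨆ c, f.eigenspace c = ⊤) (c : ℂ) :
    f.maxGenEigenspace c = f.eigenspace c := by
  have hle : ∀ c, f.eigenspace c ≤ f.maxGenEigenspace c := fun c =>
    (f.genEigenspace c).monotone le_top
  refine le_antisymm ?_ (hle c)
  have h1 : f.eigenspace c ⊔ ⨆ j ≠ c, f.eigenspace j = ⊤ := by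
    rw [eq_top_iff, ← hf]
    refine iSup_le fun j => ?_
    by_cases hj : j = c
    · exact hj ▸ le_sup_left
    · exact (le_iSup₂ (f := fun j (_ : j ≠ c) => f.eigenspace j) j hj).trans le_sup_right
  have h2 : (⨆ j ≠ c, f.eigenspace j) ⊓ f.maxGenEigenspace c = ⊥ :=
    eq_bot_iff.2 <| (inf_le_inf_right _ (iSup₂_mono fun j _ => hle j)).trans
      (f.independent_maxGenEigenspace c).symm.le_bot
  calc f.maxGenEigenspace c
      = (f.eigenspace c ⊔ ⨆ j ≠ c, f.eigenspace j) ⊓ f.maxGenEigenspace c := by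
        rw [h1, top_inf_eq]
    _ = f.eigenspace c := by rw [sup_inf_assoc_of_le _ (hle c), h2, sup_bot_eq]
    _ ≤ _ := le_rfl

/-- A commuting family of diagonalizable operators is simultaneously diagonalizable. -/
theorem iSup_iInf_eigenspace_eq_top {ι V : Type*} [AddCommGroup V] [Module ℂ V]
    [FiniteDimensional ℂ V] (f : ι → Module.End ℂ V) (hcomm : ∀ i j, Commute (f i) (f j))
    (hf : ∀ i, ⨆ c, (f i).eigenspace c = ⊤) :
    ⨆ χ : ι → ℂ, ⨅ i, (f i).eigenspace (χ i) = ⊤ := by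
  have := Module.End.iSup_iInf_maxGenEigenspace_eq_top_of_iSup_maxGenEigenspace_eq_top_of_commute
    f (fun i j _ => hcomm i j) fun i => Module.End.iSup_maxGenEigenspace_eq_top _
  simpa only [maxGenEigenspace_eq_of_iSup_eigenspace (hf _)] using this

/-- An operator of finite order is diagonalizable. -/
theorem iSup_eigenspace_eq_top_of_pow_eq_one {V : Type*} [AddCommGroup V] [Module ℂ V]
    [FiniteDimensional ℂ V] {f : Module.End ℂ V} {m : ℕ} (hm : 0 < m) (hf : f ^ m = 1) :
    ⨆ c, f.eigenspace c = ⊤ := by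
  refine Module.End.IsSemisimple.iSup_eigenspace_eq_top ?_
  refine Module.End.isSemisimple_of_squarefree_aeval_eq_zero
    (p := Polynomial.X ^ m - Polynomial.C 1) ?_ (by simp [hf])
  exact (Polynomial.separable_X_pow_sub_C 1 (by exact_mod_cast hm.ne') one_ne_zero).squarefree

/-- A set of pairs `(m, d)`, with `d` in a lattice, which is stable under `(m + 2, d) ↦ (m, d)` and
under translating `d` by multiples of `m`, is bounded if it is bounded over each `d`. -/
theorem exists_bound_of_translation {n : ℕ} {S : Set (ℕ × (Fin n → ℤ))} {M : ℕ} (hM : 0 < M)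
    (h1 : ∀ m d, (m + 2, d) ∈ S → (m, d) ∈ S)
    (h2 : ∀ m d (s : Fin n → ℤ), (m, d) ∈ S → (m, fun i => d i + m * M * s i) ∈ S)
    (h3 : ∀ d, ∃ B, ∀ m, (m, d) ∈ S → m ≤ B) : ∃ B, ∀ m d, (m, d) ∈ S → m ≤ B := by
  have hdown : ∀ m j d, (m + 2 * j, d) ∈ S → (m, d) ∈ S := by
    intro m j d
    induction j with
    | zero => exact id
    | succ j ih => exact fun hj => ih (h1 _ _ (by rwa [mul_add, ← add_assoc] at hj))
  suffices ∀ j : ℕ, ∀ R : ℕ, ∃ B : ℕ, ∀ m d, (m, d) ∈ S →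
      (∀ i : Fin n, j ≤ i → 0 ≤ d i ∧ d i ≤ R) → m ≤ B by
    obtain ⟨B, hB⟩ := this n 0
    exact ⟨B, fun m d h => hB m d h fun i hi => absurd i.2 (by omega)⟩
  intro j
  induction j with
  | zero =>
    intro R
    choose b hb using h3
    have hfin : (Set.Icc (0 : Fin n → ℤ) fun _ => (R : ℤ)).Finite := Set.finite_Icc _ _
    obtain ⟨B, hB⟩ := (hfin.image b).bddAbove
    refine ⟨B, fun m d h hd => (hb d m h).trans (hB ⟨d, ⟨fun i => ?_, fun i => ?_⟩, rfl⟩)⟩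
    · exact (hd i (Nat.zero_le _)).1
    · exact (hd i (Nat.zero_le _)).2
  | succ j ih =>
    intro R
    by_cases hj : n ≤ j
    · obtain ⟨B, hB⟩ := ih R
      exact ⟨B, fun m d h _ => hB m d h fun i hi => absurd i.2 (by omega)⟩
    rw [not_le] at hj
    let c : Fin n := ⟨j, hj⟩
    have reduce : ∀ m d, (m, d) ∈ S → (∀ i : Fin n, j + 1 ≤ i → 0 ≤ d i ∧ d i ≤ R) →
        ∀ q : ℤ, ∃ d', (m, d') ∈ S ∧ d' c = d c + m * M * q ∧
          ∀ i : Fin n, j + 1 ≤ i → 0 ≤ d' i ∧ d' i ≤ R := by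
      intro m d h hd q
      refine ⟨_, h2 m d (Pi.single c q) h, by simp, fun i hi => ?_⟩
      have : i ≠ c := fun h => by simp [h, c] at hi
      simpa [this] using hd i hi
    obtain ⟨B₁, hB₁⟩ := ih (R + 2 * M)
    obtain ⟨B₂, hB₂⟩ := ih (R + (B₁ + 2) * M)
    refine ⟨B₂, fun m d h hd => ?_⟩
    rcases Nat.eq_zero_or_pos m with rfl | hm
    · exact Nat.zero_le _
    have hmM : (0 : ℤ) < m * M := by positivity
    obtain ⟨d', hd', hc, hbox⟩ := reduce m d h hd (-(d c / (m * M)))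
    have hc0 : 0 ≤ d' c := by
      have := Int.emod_nonneg (d c) hmM.ne'
      rw [Int.emod_def] at this
      linarith
    have hc1 : d' c < m * M := by
      have := Int.emod_lt_of_pos (d c) hmM
      rw [Int.emod_def] at this
      linarith
    have hM' : (0 : ℤ) < M := by exact_mod_cast hM
    -- the quotient by `M`, decreased by at most one, is a valid first coordinate
    have hc2 : d' c ≤ (B₁ + 2) * M := by
      set t := d' c / (M : ℤ) with ht
      have ht0 : 0 ≤ t := Int.ediv_nonneg hc0 hM'.le
      have htm : t < m := Int.ediv_lt_of_lt_mul hM' hc1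
      have ht1 : t * M ≤ d' c := Int.ediv_mul_le _ hM'.ne'
      have ht2 : d' c < (t + 1) * M := Int.lt_ediv_add_one_mul_self _ hM'
      rcases ht0.eq_or_lt with ht3 | ht3
      · nlinarith
      obtain ⟨k, i, hki, hkt, htk⟩ : ∃ k i : ℕ, k + 2 * i = m ∧ (k : ℤ) ≤ t ∧ t ≤ k + 1 := by
        obtain ⟨a, ha⟩ := Int.eq_ofNat_of_zero_le ht0
        rcases Nat.even_or_odd' (m - a) with ⟨b, hb | hb⟩
        · exact ⟨a, b, by omega, by omega, by omega⟩
        · exact ⟨a - 1, b + 1, by omega, by omega, by omega⟩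
      obtain ⟨d'', hd'', hc'', hbox''⟩ := reduce k d' (hdown k i d' (hki ▸ hd')) hbox (-1)
      have hk : k ≤ B₁ := by
        refine hB₁ k d'' hd'' fun i hi => ?_
        rcases Nat.lt_or_ge j i with hji | hji
        · have := hbox'' i hji
          push_cast
          constructor <;> linarith
        · have : i = c := Fin.ext (le_antisymm hji hi)
          rw [this, hc'']
          push_cast
          constructor <;> nlinarith
      have : (k : ℤ) ≤ B₁ := by exact_mod_cast hk
      nlinarith
    refine hB₂ m d' hd' fun i hi => ?_
    rcases Nat.lt_or_ge j i with hji | hji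
    · have := hbox i hji
      push_cast
      constructor
      · exact this.1
      · nlinarith
    · have : i = c := Fin.ext (le_antisymm hji hi)
      rw [this]
      push_cast
      exact ⟨hc0, by linarith⟩

theorem exists_pow_apply_eq_zero {V : Type*} [AddCommGroup V] [Module ℂ V]
    [FiniteDimensional ℂ V] {e h : Module.End ℂ V} {a : ℂ} (ha : a ≠ 0)
    (he : ∀ v, h (e v) = e (h v) + a • e v) {c : ℂ} {v : V} (hv : h v = c • v) :
    ∃ N : ℕ, (e ^ N) v = 0 := by
  by_contra! hne
  have hpow : ∀ n : ℕ, h ((e ^ n) v) = (c + n * a) • (e ^ n) v := by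
    intro n
    induction n with
    | zero => simpa using hv
    | succ n ih =>
      rw [pow_succ', Module.End.mul_apply, he, ih, map_smul, ← add_smul]
      push_cast
      ring_nf
  refine Set.infinite_of_injective_forall_mem (f := fun n : ℕ => c + n * a) ?_ ?_
    (h.finite_hasEigenvalue)
  · intro i j hij
    simpa [ha] using hij
  · exact fun n => Module.End.hasEigenvalue_of_hasEigenvector
      ⟨Module.End.mem_eigenspace_iff.2 (hpow n), hne n⟩

namespace PreT

variable {P : PreT}

instance : FiniteDimensional ℂ P.g := P.gfin

theorem ξ_ne_zero (i : Fin P.n) : P.ξ i ≠ 0 := (P.ξprim i).ne_zero (P.mpos i).ne'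

theorem mem_gr {k : Fin P.n → ℤ} {x : P.g} : x ∈ P.gr k ↔ ∀ i, P.σ i x = P.ξ i ^ k i • x := by
  simp [gr, Submodule.mem_iInf, sub_eq_zero]

theorem zpow_eq_one_of_inΓ {r : Fin P.n → ℤ} (hr : P.inΓ r) (i : Fin P.n) :
    P.ξ i ^ r i = 1 := ((P.ξprim i).zpow_eq_one_iff_dvd _).2 (hr i)

theorem gr_eq_of_inΓ {k l : Fin P.n → ℤ} (h : P.inΓ (l - k)) : P.gr l = P.gr k := by
  have : ∀ i, P.ξ i ^ l i = P.ξ i ^ k i := fun i => by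
    have := zpow_eq_one_of_inΓ h i
    rwa [Pi.sub_apply, zpow_sub₀ (ξ_ne_zero i), div_eq_one_iff_eq (zpow_ne_zero _ (ξ_ne_zero i))]
      at this
  ext x
  simp only [mem_gr, this]

theorem lie_mem_gr {k l : Fin P.n → ℤ} {x y : P.g} (hx : x ∈ P.gr k) (hy : y ∈ P.gr l) :
    ⁅x, y⁆ ∈ P.gr (k + l) := by
  rw [mem_gr] at *
  intro i
  rw [LieEquiv.map_lie, hx, hy, smul_lie, lie_smul, smul_smul, Pi.add_apply,
    zpow_add₀ (ξ_ne_zero i)]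

theorem inΓ_of_bil_ne_zero {k l : Fin P.n → ℤ} {x y : P.g} (hx : x ∈ P.gr k) (hy : y ∈ P.gr l)
    (hxy : P.bil x y ≠ 0) : P.inΓ (k + l) := by
  rw [mem_gr] at *
  intro i
  rw [← (P.ξprim i).zpow_eq_one_iff_dvd, Pi.add_apply, zpow_add₀ (ξ_ne_zero i)]
  have := P.bil_aut i x y
  rw [hx, hy] at this
  simp only [map_smul, LinearMap.smul_apply, smul_eq_mul] at this
  exact mul_right_cancel₀ hxy (by linear_combination this)

theorem iSup_eigenspace_σ (i : Fin P.n) :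
    ⨆ c, Module.End.eigenspace (P.σ i).toLinearEquiv.toLinearMap c = ⊤ := by
  refine iSup_eigenspace_eq_top_of_pow_eq_one (P.mpos i) ?_
  ext x
  rw [Module.End.pow_apply]
  exact P.σord i x

theorem exists_zpow_of_eigenvector {i : Fin P.n} {c : ℂ} {x : P.g} (hx : x ≠ 0)
    (hc : P.σ i x = c • x) : ∃ k : ℤ, c = P.ξ i ^ k := by
  have hpow : ∀ j : ℕ, (fun y => P.σ i y)^[j] x = c ^ j • x := by
    intro j
    induction j with
    | zero => simp
    | succ j ih => rw [Function.iterate_succ_apply', ih, map_smul, hc, smul_smul, pow_succ]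
  have h1 := (P.σord i x).symm.trans (hpow _)
  have h2 : c ^ P.m i = 1 := by
    have : (c ^ P.m i - 1) • x = 0 := by rw [sub_smul, ← h1, one_smul, sub_self]
    simpa [hx, sub_eq_zero] using this
  have : NeZero (P.m i) := ⟨(P.mpos i).ne'⟩
  obtain ⟨k, -, hk⟩ := (P.ξprim i).eq_pow_of_pow_eq_one h2
  exact ⟨k, by simpa using hk.symm⟩

theorem iSup_gr_eq_top : ⨆ k, P.gr k = ⊤ := by
  have hcomm : ∀ i j, Commute (P.σ i).toLinearEquiv.toLinearMap
      (P.σ j).toLinearEquiv.toLinearMap := fun i j => LinearMap.ext fun x => P.σcomm i j x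
  rw [eq_top_iff, ← iSup_iInf_eigenspace_eq_top _ hcomm iSup_eigenspace_σ]
  refine iSup_le fun χ x hx => ?_
  by_cases hx0 : x = 0
  · exact hx0 ▸ zero_mem _
  simp only [Submodule.mem_iInf, Module.End.mem_eigenspace_iff] at hx
  choose k hk using fun i => exists_zpow_of_eigenvector hx0 (hx i)
  refine Submodule.mem_iSup_of_mem k (mem_gr.2 fun i => ?_)
  rw [← hk]
  exact hx i

end PreT

namespace Cartan

variable {P : PreT} {C : Cartan P}

open PreT

theorem mem_wtfull {α : Module.Dual ℂ C.h0} {x : P.g} :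
    x ∈ C.wtfull α ↔ ∀ h : C.h0, ⁅(h : P.g), x⁆ = α h • x := by
  simp [wtfull, Submodule.mem_iInf, sub_eq_zero]

theorem wtg_eq_of_inΓ {k l : Fin P.n → ℤ} (h : P.inΓ (l - k)) (α : Module.Dual ℂ C.h0) :
    C.wtg l α = C.wtg k α := by
  rw [wtg, wtg, gr_eq_of_inΓ h]

theorem lie_mem_wtg {k l : Fin P.n → ℤ} {α β : Module.Dual ℂ C.h0} {x y : P.g}
    (hx : x ∈ C.wtg k α) (hy : y ∈ C.wtg l β) : ⁅x, y⁆ ∈ C.wtg (k + l) (α + β) := by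
  refine ⟨lie_mem_gr hx.1 hy.1, mem_wtfull.2 fun h => ?_⟩
  rw [leibniz_lie, mem_wtfull.1 hx.2, mem_wtfull.1 hy.2, smul_lie, lie_smul, ← add_smul,
    LinearMap.add_apply]

theorem ad_pow_mem_wtg {k l : Fin P.n → ℤ} {α β : Module.Dual ℂ C.h0} {x y : P.g}
    (hx : x ∈ C.wtg k α) (hy : y ∈ C.wtg l β) (m : ℕ) :
    ((LieAlgebra.ad ℂ P.g x) ^ m) y ∈ C.wtg (l + m • k) (β + m • α) := by
  induction m with
  | zero => simpa using hy
  | succ m ih =>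
    rw [pow_succ', Module.End.mul_apply, LieAlgebra.ad_apply]
    convert! lie_mem_wtg hx ih using 2 <;> rw [succ_nsmul] <;> abel

theorem eq_neg_of_bil_ne_zero {α β : Module.Dual ℂ C.h0} {x y : P.g}
    (hx : x ∈ C.wtfull α) (hy : y ∈ C.wtfull β) (hxy : P.bil x y ≠ 0) : β = -α := by
  ext h
  have h1 := P.bil_invariant x h y
  rw [← lie_skew, mem_wtfull.1 hx, mem_wtfull.1 hy] at h1
  simp only [map_smul, map_neg, LinearMap.neg_apply, LinearMap.smul_apply, smul_eq_mul] at h1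
  rw [LinearMap.neg_apply]
  exact mul_right_cancel₀ hxy (by linear_combination -h1)

theorem mem_wtg_zero_iff {x : P.g} : x ∈ C.wtg 0 0 ↔ x ∈ C.h0 := by
  constructor
  · intro hx
    refine C.h0_selfnorm x hx.1 fun h hh => ?_
    have := mem_wtfull.1 hx.2 ⟨h, hh⟩
    simp only [LinearMap.zero_apply, zero_smul] at this
    rw [this]
    exact zero_mem _
  · intro hx
    exact ⟨C.h0_le hx, mem_wtfull.2 fun h => by simp [C.h0_abelian _ h.2 _ hx]⟩

end Cartan

namespace Torus

variable {P : PreT} {C : Cartan P} (T : Torus P C)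

open PreT Cartan

theorem iSup_eigenspace_ad (T : Torus P C) (hd : ∀ h : C.h0, P.gr 0 ≤
    ⨆ c, (LieAlgebra.ad ℂ P.g (h : P.g)).eigenspace c) (h : C.h0) :
    ⨆ c, (LieAlgebra.ad ℂ P.g (h : P.g)).eigenspace c = ⊤ := by
  have hle : ∀ α, C.wtfull α ≤ ⨆ c, (LieAlgebra.ad ℂ P.g (h : P.g)).eigenspace c := fun α x hx =>
    Submodule.mem_iSup_of_mem (α h) (Module.End.mem_eigenspace_iff.2 (mem_wtfull.1 hx h))
  rw [eq_top_iff, ← iSup_gr_eq_top]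
  refine iSup_le fun k => ?_
  by_cases hk : P.inΓ k
  · rw [gr_eq_of_inΓ (k := 0) (by simpa using hk)]
    exact hd h
  by_cases hb : P.gr k = ⊥
  · simp [hb]
  obtain ⟨U, W, -, -, -, hUW, hU, hW⟩ := T.cond_M k hk hb
  rw [← hUW]
  refine sup_le (fun x hx => hle 0 (mem_wtfull.2 fun h => ?_)) ?_
  · simpa using hU h (C.h0_le h.2) x hx
  · rcases hW with rfl | ⟨-, -, hW⟩
    · exact bot_le
    · exact hW.trans (iSup₂_le fun α _ => hle α)

theorem iSup_wtg_eq_top (T : Torus P C) (hd : ∀ h : C.h0, P.gr 0 ≤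
    ⨆ c, (LieAlgebra.ad ℂ P.g (h : P.g)).eigenspace c) :
    ⨆ l, ⨆ β, C.wtg l β = ⊤ := by
  let f : Fin P.n ⊕ C.h0 → Module.End ℂ P.g :=
    Sum.elim (fun i => (P.σ i).toLinearEquiv.toLinearMap) fun h => LieAlgebra.ad ℂ P.g (h : P.g)
  have hσh : ∀ (i : Fin P.n) (h : C.h0), Commute (P.σ i).toLinearEquiv.toLinearMap
      (LieAlgebra.ad ℂ P.g (h : P.g)) := by
    refine fun i h => LinearMap.ext fun x => ?_
    have := mem_gr.1 (C.h0_le h.2) i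
    simp only [Pi.zero_apply, zpow_zero, one_smul] at this
    change P.σ i ⁅(h : P.g), x⁆ = ⁅(h : P.g), P.σ i x⁆
    rw [LieEquiv.map_lie, this]
  have hcomm : ∀ i j, Commute (f i) (f j) := by
    rintro (i | h) (j | h')
    · exact LinearMap.ext fun x => P.σcomm i j x
    · exact hσh i h'
    · exact (hσh j h).symm
    · refine LinearMap.ext fun x => ?_
      change ⁅(h : P.g), ⁅(h' : P.g), x⁆⁆ = ⁅(h' : P.g), ⁅(h : P.g), x⁆⁆
      rw [leibniz_lie, C.h0_abelian _ h.2 _ h'.2, zero_lie, zero_add]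
  have hdiag : ∀ i, ⨆ c, (f i).eigenspace c = ⊤ := by
    rintro (i | h)
    · exact iSup_eigenspace_σ i
    · exact T.iSup_eigenspace_ad hd h
  rw [eq_top_iff, ← iSup_iInf_eigenspace_eq_top f hcomm hdiag]
  refine iSup_le fun χ x hx => ?_
  by_cases hx0 : x = 0
  · exact hx0 ▸ zero_mem _
  simp only [Submodule.mem_iInf, Module.End.mem_eigenspace_iff] at hx
  choose k hk using fun i => exists_zpow_of_eigenvector hx0 (hx (Sum.inl i))
  have hχ : ∀ h : C.h0, ⁅(h : P.g), x⁆ = χ (Sum.inr h) • x := fun h => hx (Sum.inr h)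
  have hinj : Function.Injective fun c : ℂ => c • x := smul_left_injective ℂ hx0
  let α : Module.Dual ℂ C.h0 :=
    { toFun := fun h => χ (Sum.inr h)
      map_add' := fun h h' => hinj <| by
        simp only
        rw [← hχ, add_smul, ← hχ, ← hχ, Submodule.coe_add, add_lie]
      map_smul' := fun c h => hinj <| by
        simp only [RingHom.id_apply, smul_eq_mul]
        rw [← hχ, mul_smul, ← hχ, Submodule.coe_smul, smul_lie] }
  refine Submodule.mem_iSup_of_mem k (Submodule.mem_iSup_of_mem α ⟨mem_gr.2 fun i => ?_,
    mem_wtfull.2 hχ⟩)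
  rw [← hk]
  exact hx (Sum.inl i)

end Torus

theorem finite_of_separating {H ι : Type*} [AddCommGroup H] [Module ℂ H] [Finite ι] (b : ι → H)
    (hb : ∀ lam : Module.Dual ℂ H, (∀ i, lam (b i) = 0) → lam = 0) (S : Set (Module.Dual ℂ H))
    (hS : ∀ i, ((fun lam : Module.Dual ℂ H => lam (b i)) '' S).Finite) : S.Finite := by
  let F : Module.Dual ℂ H → ι → ℂ := fun lam i => lam (b i)
  have hF : Function.Injective F := fun lam mu h =>
    sub_eq_zero.1 (hb _ fun i => by simpa [sub_eq_zero] using congrFun h i)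
  refine Set.Finite.of_finite_image ?_ hF.injOn
  refine (Set.Finite.pi' hS).subset ?_
  rintro _ ⟨lam, hlam, rfl⟩ i
  exact ⟨lam, hlam, rfl⟩

namespace Cartan

variable {P : PreT} (C : Cartan P)

/-- the elements of `𝔥_{0̄}` act semisimply on `𝔤_{0̄}`. -/
def AdDiag : Prop :=
  ∀ h : C.h0, P.gr 0 ≤ ⨆ c, (LieAlgebra.ad ℂ P.g (h : P.g)).eigenspace c

/-- the nonzero roots of `𝔤_{0̄}`. -/
def Δ0 : Set (Module.Dual ℂ C.h0) := {α | α ≠ 0 ∧ C.wtg 0 α ≠ ⊥}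

variable {C}

theorem Δ0_sub : C.Δ0 ⊆ C.Δen := fun _ h => ⟨h.1, 0, h.2⟩

theorem finite_Δ0 : C.Δ0.Finite := by
  let b := Module.finBasis ℂ C.h0
  refine finite_of_separating b (fun lam h => b.ext fun i => by simpa using h i) _ fun i => ?_
  refine (LieAlgebra.ad ℂ P.g (b i : P.g)).finite_hasEigenvalue.subset ?_
  rintro _ ⟨α, ⟨-, hα⟩, rfl⟩
  obtain ⟨x, hx, hx0⟩ := (Submodule.ne_bot_iff _).1 hα
  exact Module.End.hasEigenvalue_of_hasEigenvector
    ⟨Module.End.mem_eigenspace_iff.2 (mem_wtfull.1 hx.2 (b i)), hx0⟩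

end Cartan

namespace Torus

variable {P : PreT} {C : Cartan P} (T : Torus P C)

open PreT Cartan

theorem exists_bil_ne_zero (T : Torus P C) (hd : C.AdDiag) {k : Fin P.n → ℤ}
    {α : Module.Dual ℂ C.h0} {x : P.g}
    (hx : x ∈ C.wtg k α) (hx0 : x ≠ 0) : ∃ y ∈ C.wtg (-k) (-α), P.bil x y ≠ 0 := by
  by_contra! H
  refine hx0 (P.bil_nondeg x fun y => ?_)
  have : (⊤ : Submodule ℂ P.g) ≤ LinearMap.ker (P.bil x) := by
    rw [← T.iSup_wtg_eq_top hd]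
    refine iSup₂_le fun l β y hy => ?_
    by_contra hxy
    have hxy : P.bil x y ≠ 0 := hxy
    have hβ := eq_neg_of_bil_ne_zero hx.2 hy.2 hxy
    have hl := inΓ_of_bil_ne_zero hx.1 hy.1 hxy
    refine hxy (H y ?_)
    rw [← hβ, ← wtg_eq_of_inΓ (k := -k) (l := l) (by simpa [sub_neg_eq_add, add_comm] using hl)]
    exact hy
  exact this (Submodule.mem_top (x := y))

theorem h0_ext (T : Torus P C) (hd : C.AdDiag) {h h' : C.h0}
    (H : ∀ h'' : C.h0, P.bil (h : P.g) (h'' : P.g) = P.bil (h' : P.g) (h'' : P.g)) : h = h' := by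
  by_contra hne
  obtain ⟨y, hy, hxy⟩ := T.exists_bil_ne_zero hd (mem_wtg_zero_iff.2 (h - h').2)
    (by simpa [sub_eq_zero] using hne)
  rw [neg_zero, neg_zero] at hy
  refine hxy ?_
  have := H ⟨y, mem_wtg_zero_iff.1 hy⟩
  simpa [sub_eq_zero] using this

theorem cnorm_ne_zero (hd : C.AdDiag) {α : Module.Dual ℂ C.h0} (hα : α ∈ C.Δen) :
    T.cnorm α ≠ 0 := by
  intro h0
  have : T.coroot α = 0 := T.h0_ext hd fun h => by simp [T.cnorm_spec α hα, h0]
  simpa [this] using T.coroot_two α hα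

theorem exists_lie_eq_coroot (hd : C.AdDiag) {k : Fin P.n → ℤ} {α : Module.Dual ℂ C.h0}
    (hα : α ∈ C.Δen) {x : P.g} (hx : x ∈ C.wtg k α) (hx0 : x ≠ 0) :
    ∃ y ∈ C.wtg (-k) (-α), ⁅x, y⁆ = (T.coroot α : P.g) := by
  obtain ⟨y, hy, hxy⟩ := T.exists_bil_ne_zero hd hx hx0
  have hc := T.cnorm_ne_zero hd hα
  have hmem : ⁅x, y⁆ ∈ C.h0 := mem_wtg_zero_iff.1 (by simpa using lie_mem_wtg hx hy)
  refine ⟨(T.cnorm α / P.bil x y) • y, Submodule.smul_mem _ _ hy, ?_⟩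
  have key : (T.cnorm α / P.bil x y) • (⟨⁅x, y⁆, hmem⟩ : C.h0) = T.coroot α := by
    refine T.h0_ext hd fun h => ?_
    have h1 := mem_wtfull.1 hy.2 h
    rw [← lie_skew, LinearMap.neg_apply, neg_smul, neg_inj] at h1
    rw [T.cnorm_spec α hα]
    simp only [Submodule.coe_smul, map_smul, LinearMap.smul_apply, P.bil_invariant, h1,
      smul_eq_mul]
    field_simp
  simpa using congrArg (Subtype.val) key

theorem nilpotentSl2_ad {k : Fin P.n → ℤ} {α : Module.Dual ℂ C.h0} (hα : α ∈ C.Δen) {x y : P.g}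
    (hx : x ∈ C.wtg k α) (hy : y ∈ C.wtg (-k) (-α)) (hxy : ⁅x, y⁆ = (T.coroot α : P.g)) :
    NilpotentSl2 (LieAlgebra.ad ℂ P.g x) (LieAlgebra.ad ℂ P.g y)
      (LieAlgebra.ad ℂ P.g (T.coroot α : P.g)) := by
  have h2 := T.coroot_two α hα
  have he : ∀ v : P.g, ⁅(T.coroot α : P.g), ⁅x, v⁆⁆ =
      ⁅x, ⁅(T.coroot α : P.g), v⁆⁆ + (2 : ℂ) • ⁅x, v⁆ := fun v => by
    rw [leibniz_lie, mem_wtfull.1 hx.2, h2, smul_lie, add_comm]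
  have hf : ∀ v : P.g, ⁅(T.coroot α : P.g), ⁅y, v⁆⁆ =
      ⁅y, ⁅(T.coroot α : P.g), v⁆⁆ + (-2 : ℂ) • ⁅y, v⁆ := fun v => by
    rw [leibniz_lie, mem_wtfull.1 hy.2, LinearMap.neg_apply, h2, smul_lie, add_comm]
  exact
  { he := he
    hf := fun v => by simpa [sub_eq_add_neg] using hf v
    ef := fun v => by
      simp only [LieAlgebra.ad_apply]
      rw [leibniz_lie, hxy, add_comm]
    nil_e := fun c v hv => exists_pow_apply_eq_zero two_ne_zero he hv
    nil_f := fun c v hv => exists_pow_apply_eq_zero (neg_ne_zero.2 two_ne_zero) hf hv }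

/-- an `𝔰𝔩₂`-triple in `𝔤` attached to a root. -/
theorem exists_sl2 (hd : C.AdDiag) {k : Fin P.n → ℤ} {α : Module.Dual ℂ C.h0}
    (hα : α ∈ C.Δen) (hk : C.wtg k α ≠ ⊥) :
    ∃ x ∈ C.wtg k α, ∃ y ∈ C.wtg (-k) (-α), ⁅x, y⁆ = (T.coroot α : P.g) := by
  obtain ⟨x, hx, hx0⟩ := (Submodule.ne_bot_iff _).1 hk
  exact ⟨x, hx, T.exists_lie_eq_coroot hd hα hx hx0⟩

theorem wtg_neg_ne_bot (T : Torus P C) (hd : C.AdDiag) {k : Fin P.n → ℤ} {α : Module.Dual ℂ C.h0}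
    (hk : C.wtg k α ≠ ⊥) : C.wtg (-k) (-α) ≠ ⊥ := by
  obtain ⟨x, hx, hx0⟩ := (Submodule.ne_bot_iff _).1 hk
  obtain ⟨y, hy, hxy⟩ := T.exists_bil_ne_zero hd hx hx0
  exact (Submodule.ne_bot_iff _).2 ⟨y, hy, fun h => hxy (by simp [h])⟩

theorem neg_mem_Δ0 (T : Torus P C) (hd : C.AdDiag) {α : Module.Dual ℂ C.h0} (hα : α ∈ C.Δ0) :
    -α ∈ C.Δ0 :=
  ⟨neg_ne_zero.2 hα.1, by simpa using T.wtg_neg_ne_bot hd hα.2⟩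

theorem exists_int_coroot (hd : C.AdDiag) {k l : Fin P.n → ℤ} {α β : Module.Dual ℂ C.h0}
    (hα : α ∈ C.Δen) (hk : C.wtg k α ≠ ⊥) (hl : C.wtg l β ≠ ⊥) :
    ∃ z : ℤ, β (T.coroot α) = z ∧ (z < 0 → C.wtg (k + l) (α + β) ≠ ⊥) ∧
      (0 ≤ z → C.wtg (l + z.toNat • (-k)) (β + z.toNat • (-α)) ≠ ⊥) := by
  obtain ⟨x, hx, y, hy, hxy⟩ := T.exists_sl2 hd hα hk
  obtain ⟨v, hv, hv0⟩ := (Submodule.ne_bot_iff _).1 hl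
  have H := T.nilpotentSl2_ad hα hx hy hxy
  have hv1 : (LieAlgebra.ad ℂ P.g (T.coroot α : P.g)) v = β (T.coroot α) • v :=
    mem_wtfull.1 hv.2 (T.coroot α)
  obtain ⟨z, hz⟩ := H.exists_int hv1 hv0
  rw [hz] at hv1
  refine ⟨z, hz, fun hneg => ?_, fun hpos => ?_⟩
  · exact (Submodule.ne_bot_iff _).2 ⟨_, lie_mem_wtg hx hv, H.e_apply_ne_zero hv1 hv0 hneg⟩
  · refine (Submodule.ne_bot_iff _).2 ⟨_, ad_pow_mem_wtg hy hv z.toNat, H.f_pow_ne_zero ?_ hv0⟩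
    rw [hv1]
    congr 1
    exact_mod_cast (Int.toNat_of_nonneg hpos).symm

theorem reflection_mem (hd : C.AdDiag) {α β : Module.Dual ℂ C.h0} (hα : α ∈ C.Δ0)
    (hβ : β ∈ C.Δ0) : β - β (T.coroot α) • α ∈ C.Δ0 := by
  refine ⟨fun h => hβ.1 ?_, ?_⟩
  · have h1 := congrArg (fun f => f (T.coroot α)) (sub_eq_zero.1 h)
    simp only [LinearMap.smul_apply, T.coroot_two α (Δ0_sub hα), smul_eq_mul] at h1
    have h2 : β (T.coroot α) = 0 := by linear_combination -h1
    simpa [h2] using h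
  · obtain ⟨z, hz, -, hpos⟩ := T.exists_int_coroot hd (Δ0_sub hα) hα.2 hβ.2
    obtain ⟨z', hz', -, hpos'⟩ :=
      T.exists_int_coroot hd (Δ0_sub (T.neg_mem_Δ0 hd hα)) (T.neg_mem_Δ0 hd hα).2 hβ.2
    rw [T.coroot_neg _ (Δ0_sub hα), map_neg, hz] at hz'
    have hzz : z' = -z := by exact_mod_cast hz'.symm
    subst hzz
    rw [hz]
    rcases le_total 0 z with h | h
    · convert! hpos h using 2
      · rw [smul_neg, sub_eq_add_neg, ← Nat.cast_smul_eq_nsmul ℂ]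
        congr 3
        exact_mod_cast (Int.toNat_of_nonneg h).symm
    · convert! hpos' (by omega) using 2
      · rw [neg_neg, sub_eq_add_neg, ← Nat.cast_smul_eq_nsmul ℂ, ← neg_smul]
        congr 2
        have := Int.toNat_of_nonneg (a := -z) (by omega)
        exact_mod_cast this.symm

theorem coroot_reflection (hd : C.AdDiag) {α β : Module.Dual ℂ C.h0} (hα : α ∈ C.Δ0)
    (hβ : β ∈ C.Δ0) : T.coroot (β - β (T.coroot α) • α) =
      T.coroot β - α (T.coroot β) • T.coroot α := by
  have hγ' := Δ0_sub (T.reflection_mem hd hα hβ)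
  have hsym : T.cnorm α * α (T.coroot β) = T.cnorm β * β (T.coroot α) := by
    rw [← T.cnorm_spec α (Δ0_sub hα), ← T.cnorm_spec β (Δ0_sub hβ), P.bil_symm]
  have h2α := T.coroot_two α (Δ0_sub hα)
  have h2β := T.coroot_two β (Δ0_sub hβ)
  set γ := β - β (T.coroot α) • α with hγ
  set x := T.coroot β - α (T.coroot β) • T.coroot α with hx
  have hbil : ∀ h : C.h0, P.bil (x : P.g) (h : P.g) = T.cnorm β * γ h := fun h => by
    simp only [hx, hγ, Submodule.coe_sub, Submodule.coe_smul, map_sub, map_smul,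
      LinearMap.sub_apply, LinearMap.smul_apply, T.cnorm_spec α (Δ0_sub hα),
      T.cnorm_spec β (Δ0_sub hβ), smul_eq_mul]
    linear_combination (-α h) * hsym
  have hγx : γ x = 2 := by
    simp only [hx, hγ, map_sub, map_smul, LinearMap.sub_apply, LinearMap.smul_apply, h2α, h2β,
      smul_eq_mul]
    ring
  have key : T.cnorm γ • x = T.cnorm β • T.coroot γ := T.h0_ext hd fun h => by
    simp only [Submodule.coe_smul, map_smul, LinearMap.smul_apply, hbil, T.cnorm_spec γ hγ',
      smul_eq_mul]
    ring
  have hcc : T.cnorm γ = T.cnorm β := by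
    have := congrArg γ key
    simp only [map_smul, hγx, T.coroot_two γ hγ', smul_eq_mul] at this
    linear_combination this / 2
  rw [hcc] at key
  exact (smul_right_injective _ (T.cnorm_ne_zero hd (Δ0_sub hβ)) key).symm

theorem eq_zero_of_coroot_eq_zero (hd : C.AdDiag) {lam : Module.Dual ℂ C.h0}
    (h : ∀ α ∈ C.Δ0, lam (T.coroot α) = 0) : lam = 0 := by
  let F : C.h0 →ₗ[ℂ] Module.Dual ℂ C.h0 := (P.bil.domRestrict₁₂ C.h0 C.h0)
  have hF : ∀ x y : C.h0, F x y = P.bil (x : P.g) (y : P.g) := fun _ _ => rfl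
  have hinj : Function.Injective F := fun x y hxy => T.h0_ext hd fun z => by
    rw [← hF, ← hF, hxy]
  obtain ⟨t, rfl⟩ := (LinearMap.injective_iff_surjective_of_finrank_eq_finrank
    (Subspace.dual_finrank_eq).symm).1 hinj lam
  have ht : ∀ α ∈ C.Δ0, α t = 0 := fun α hα => by
    have := h α hα
    rw [hF, P.bil_symm, T.cnorm_spec α (Δ0_sub hα)] at this
    exact (mul_eq_zero.1 this).resolve_left (T.cnorm_ne_zero hd (Δ0_sub hα))
  have hcent : ∀ x ∈ P.gr 0, ⁅x, (t : P.g)⁆ = 0 := by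
    refine fun x hx => P.bil_nondeg _ fun y => ?_
    have : (⊤ : Submodule ℂ P.g) ≤ LinearMap.ker (P.bil ⁅x, (t : P.g)⁆) := by
      rw [← T.iSup_wtg_eq_top hd]
      refine iSup₂_le fun l β y hy => ?_
      rw [LinearMap.mem_ker, P.bil_invariant, mem_wtfull.1 hy.2, map_smul, smul_eq_mul,
        mul_eq_zero, or_iff_not_imp_right]
      intro hxy
      by_cases hβ : β = 0
      · simp [hβ]
      have hl := inΓ_of_bil_ne_zero hx hy.1 hxy
      refine ht β ⟨hβ, ?_⟩
      rw [← wtg_eq_of_inΓ (k := 0) (l := l) (by simpa using hl)]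
      exact (Submodule.ne_bot_iff _).2 ⟨y, hy, fun h => hxy (by simp [h])⟩
    exact this (Submodule.mem_top (x := y))
  suffices t = 0 by rw [this, map_zero]
  rcases T.g0_ideals (Submodule.span ℂ {(t : P.g)})
    (by simpa using C.h0_le t.2) (fun x hx u hu => by
      obtain ⟨c, rfl⟩ := Submodule.mem_span_singleton.1 hu
      rw [lie_smul, hcent x hx, smul_zero]
      exact zero_mem _) with h0 | h0
  · simpa using h0
  · obtain ⟨x, hx, y, hy, hxy⟩ := T.g0_nonabelian
    rw [← h0] at hy
    obtain ⟨c, rfl⟩ := Submodule.mem_span_singleton.1 hy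
    exact absurd (by rw [lie_smul, hcent x hx, smul_zero]) hxy

/-- a Weyl group invariant form on `𝔥_{0̄}*`. -/
def rootForm (lam mu : Module.Dual ℂ C.h0) : ℂ :=
  ∑ β ∈ finite_Δ0.toFinset, lam (T.coroot β) * mu (T.coroot β)

theorem rootForm_reflection (hd : C.AdDiag) {α : Module.Dual ℂ C.h0} (hα : α ∈ C.Δ0)
    (lam mu : Module.Dual ℂ C.h0) :
    T.rootForm (lam - lam (T.coroot α) • α) (mu - mu (T.coroot α) • α) = T.rootForm lam mu := by
  have h2 := T.coroot_two α (Δ0_sub hα)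
  have hmem : ∀ β ∈ (finite_Δ0 (C := C)).toFinset,
      β - β (T.coroot α) • α ∈ (finite_Δ0 (C := C)).toFinset := fun β hβ => by
    simp only [Set.Finite.mem_toFinset] at *
    exact T.reflection_mem hd hα hβ
  have hinv : ∀ β : Module.Dual ℂ C.h0, (β - β (T.coroot α) • α) -
      (β - β (T.coroot α) • α) (T.coroot α) • α = β := fun β => by
    simp only [LinearMap.sub_apply, LinearMap.smul_apply, h2, smul_eq_mul]
    module
  refine Finset.sum_nbij' (fun β => β - β (T.coroot α) • α) (fun β => β - β (T.coroot α) • α)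
    hmem hmem (fun β _ => hinv β) (fun β _ => hinv β) fun β hβ => ?_
  rw [T.coroot_reflection hd hα (by simpa using hβ)]
  simp only [LinearMap.sub_apply, LinearMap.smul_apply, map_sub, map_smul, smul_eq_mul]
  ring

theorem rootForm_sub (hd : C.AdDiag) {α : Module.Dual ℂ C.h0} (hα : α ∈ C.Δ0)
    (lam : Module.Dual ℂ C.h0) :
    T.rootForm (lam - α) (lam - α) =
      T.rootForm lam lam - (lam (T.coroot α) - 1) * T.rootForm α α := by
  have h1 := T.rootForm_reflection hd hα lam α
  rw [T.coroot_two α (Δ0_sub hα)] at h1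
  have h2 : T.rootForm (lam - lam (T.coroot α) • α) (α - (2 : ℂ) • α) =
      -T.rootForm lam α + lam (T.coroot α) * T.rootForm α α := by
    simp only [rootForm, ← Finset.sum_neg_distrib, Finset.mul_sum, ← Finset.sum_add_distrib]
    refine Finset.sum_congr rfl fun β _ => ?_
    simp only [LinearMap.sub_apply, LinearMap.smul_apply, smul_eq_mul]
    ring
  have h3 : T.rootForm (lam - α) (lam - α) =
      T.rootForm lam lam - 2 * T.rootForm lam α + T.rootForm α α := by
    simp only [rootForm, Finset.mul_sum, ← Finset.sum_add_distrib, ← Finset.sum_sub_distrib]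
    refine Finset.sum_congr rfl fun β _ => ?_
    simp only [LinearMap.sub_apply]
    ring
  rw [h3]
  linear_combination h1 - h2

theorem exists_nat_rootForm {lam : Module.Dual ℂ C.h0}
    (h : ∀ α ∈ C.Δ0, ∃ z : ℤ, lam (T.coroot α) = z) : ∃ N : ℕ, T.rootForm lam lam = N := by
  choose! z hz using h
  refine ⟨∑ β ∈ finite_Δ0.toFinset, (z β ^ 2).toNat, ?_⟩
  rw [rootForm, Nat.cast_sum]
  refine Finset.sum_congr rfl fun β hβ => ?_
  rw [hz β (by simpa using hβ), ← pow_two]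
  exact_mod_cast (Int.toNat_of_nonneg (sq_nonneg (z β))).symm

theorem rootForm_self_ne_zero (hd : C.AdDiag) {α : Module.Dual ℂ C.h0} (hα : α ∈ C.Δ0) :
    ∃ N : ℕ, 0 < N ∧ T.rootForm α α = N := by
  have hint : ∀ β ∈ C.Δ0, ∃ z : ℤ, α (T.coroot β) = z := fun β hβ =>
    (T.exists_int_coroot hd (Δ0_sub hβ) hβ.2 hα.2).imp fun z hz => hz.1
  choose! z hz using hint
  refine ⟨∑ β ∈ finite_Δ0.toFinset, (z β ^ 2).toNat, ?_, ?_⟩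
  · refine Finset.sum_pos' (fun _ _ => Nat.zero_le _) ⟨α, by simpa using hα, ?_⟩
    have h2 : z α = 2 := by
      have := (hz α hα).symm.trans (T.coroot_two α (Δ0_sub hα))
      exact_mod_cast this
    simp [h2]
  · rw [rootForm, Nat.cast_sum]
    refine Finset.sum_congr rfl fun β hβ => ?_
    rw [hz β (by simpa using hβ), ← pow_two]
    exact_mod_cast (Int.toNat_of_nonneg (sq_nonneg (z β))).symm

theorem sum_pos_ne_zero (hd : C.AdDiag) (L : List (Module.Dual ℂ C.h0)) (hL : L ≠ [])
    (hpos : ∀ α ∈ L, α ∈ T.pos) : L.sum ≠ 0 := by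
  induction hn : L.length using Nat.strong_induction_on generalizing L with
  | _ n ih =>
  classical
  obtain ⟨α, rest, rfl⟩ := List.exists_cons_of_ne_nil hL
  intro hsum
  rw [List.sum_cons] at hsum
  have hαpos := hpos α (by simp)
  have hα := T.pos_sub hαpos
  obtain ⟨k, hk⟩ := hα.2
  have key : ∃ β ∈ rest, ∃ l, C.wtg (k + l) (α + β) ≠ ⊥ := by
    by_contra! H
    have hmem : (rest.map fun β => β (T.coroot α)).sum ∈
        AddMonoidHom.mrange (Nat.castAddMonoidHom ℂ) := by
      refine list_sum_mem fun c hc => ?_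
      obtain ⟨β, hβ, rfl⟩ := List.mem_map.1 hc
      obtain ⟨l, hl⟩ := (T.pos_sub (hpos β (by simp [hβ]))).2
      obtain ⟨z, hz, hz', -⟩ := T.exists_int_coroot hd hα hk hl
      have : 0 ≤ z := by
        by_contra hneg
        exact hz' (by omega) (H β hβ l)
      refine ⟨z.toNat, ?_⟩
      change ((z.toNat : ℕ) : ℂ) = β (T.coroot α)
      rw [hz]
      exact_mod_cast Int.toNat_of_nonneg this
    have hs : (rest.map fun β => β (T.coroot α)).sum = rest.sum (T.coroot α) :=
      (map_list_sum (LinearMap.applyₗ (R := ℂ) (M₂ := ℂ) (T.coroot α)) rest).symm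
    obtain ⟨N, hN⟩ := hmem
    rw [hs, eq_neg_of_add_eq_zero_right hsum, LinearMap.neg_apply, T.coroot_two α hα] at hN
    change ((N : ℕ) : ℂ) = -2 at hN
    have hN' : (N : ℤ) = -2 := by exact_mod_cast hN
    omega
  obtain ⟨β, hβ, l, hl⟩ := key
  have hβpos := hpos β (by simp [hβ])
  have hne : α + β ≠ 0 := fun h => T.pos_disj α hαpos (by rwa [← eq_neg_of_add_eq_zero_right h])
  have hadd := T.pos_add α hαpos β hβpos ⟨hne, _, hl⟩
  refine ih (rest.erase β).length.succ ?_ ((α + β) :: rest.erase β) (by simp) ?_ (by simp) ?_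
  · have := List.length_erase_of_mem hβ
    have := List.length_pos_of_mem hβ
    simp only [List.length_cons] at hn
    omega
  · intro γ hγ
    rcases List.mem_cons.1 hγ with rfl | hγ
    · exact hadd
    · exact hpos γ (by simp [List.mem_of_mem_erase hγ])
  · rw [List.sum_cons, add_assoc, ← List.sum_cons, ← (List.perm_cons_erase hβ).sum_eq, hsum]

end Torus

namespace TRep

variable {P : PreT} {C : Cartan P} {T : Torus P C} {X : Toroidal P C T} {M : TRep X}

open PreT Cartan

theorem ρ_lie_apply (a b : X.τ) (v : M.V) :
    M.ρ a (M.ρ b v) = M.ρ b (M.ρ a v) + M.ρ ⁅a, b⁆ v := by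
  rw [M.ρ_lie]
  simp

theorem ρ_E_zero_apply {l : Fin P.n → ℤ} {x y : P.g} (hx : x ∈ P.gr 0) (hy : y ∈ P.gr l)
    (v : M.V) : M.ρ (X.E 0 x) (M.ρ (X.E l y) v) =
      M.ρ (X.E l y) (M.ρ (X.E 0 x) v) + M.ρ (X.E l ⁅x, y⁆) v := by
  rw [ρ_lie_apply, X.br_EE 0 l x y hx hy]
  simp

theorem mem_wtSp {w : C.Wt} {v : M.V} : v ∈ M.wtSp w ↔
    (∀ h : C.h0, M.ρ (X.E 0 (h : P.g)) v = w.1 h • v) ∧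
      (∀ i, M.ρ (X.K 0 i) v = w.2.1 i • v) ∧ ∀ i, M.ρ (X.Dop 0 i) v = w.2.2 i • v := by
  simp [wtSp, Submodule.mem_iInf, sub_eq_zero, and_assoc]

/-- the weight space of `lam + δ_k`, relative to the base weight `d₀` of the derivations. -/
def latSp (M : TRep X) (d₀ : Fin P.n → ℂ) (lam : Module.Dual ℂ C.h0) (k : Fin P.n → ℤ) :
    Submodule ℂ M.V := M.wtSp (lam, 0, fun i => d₀ i + (k i : ℂ))

variable {d₀ : Fin P.n → ℂ}

theorem mem_latSp (hlz : M.LevelZero) {lam : Module.Dual ℂ C.h0} {k : Fin P.n → ℤ} {v : M.V} :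
    v ∈ M.latSp d₀ lam k ↔ (∀ h : C.h0, M.ρ (X.E 0 (h : P.g)) v = lam h • v) ∧
      ∀ i, M.ρ (X.Dop 0 i) v = (d₀ i + (k i : ℂ)) • v := by
  rw [latSp, mem_wtSp]
  simp [hlz _]

theorem ρ_E_mem_latSp (hlz : M.LevelZero) {lam α : Module.Dual ℂ C.h0} {k l : Fin P.n → ℤ}
    {x : P.g} {v : M.V} (hx : x ∈ C.wtg k α) (hv : v ∈ M.latSp d₀ lam l) :
    M.ρ (X.E k x) v ∈ M.latSp d₀ (lam + α) (l + k) := by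
  rw [mem_latSp hlz] at hv ⊢
  refine ⟨fun h => ?_, fun i => ?_⟩
  · rw [ρ_E_zero_apply (C.h0_le h.2) hx.1, hv.1, mem_wtfull.1 hx.2]
    simp only [map_smul, LinearMap.smul_apply, LinearMap.add_apply, add_smul]
  · rw [ρ_lie_apply, hv.2, X.br_DE 0 (fun i => by simp) i k x hx.1]
    simp only [zero_add, map_smul, LinearMap.smul_apply, Pi.add_apply, Int.cast_add, ← add_smul,
      add_assoc]

theorem ρ_E_pow_mem_latSp (hlz : M.LevelZero) {lam α : Module.Dual ℂ C.h0} {k l : Fin P.n → ℤ}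
    {x : P.g} {v : M.V} (hx : x ∈ C.wtg k α) (hv : v ∈ M.latSp d₀ lam l) (m : ℕ) :
    (M.ρ (X.E k x) ^ m) v ∈ M.latSp d₀ (lam + m • α) (l + m • k) := by
  induction m with
  | zero => simpa using hv
  | succ m ih =>
    rw [pow_succ', Module.End.mul_apply, succ_nsmul, succ_nsmul, ← add_assoc, ← add_assoc]
    exact ρ_E_mem_latSp hlz hx ih

theorem iSup_eigenspace_ρ (hw : M.IsWeight) (h : C.h0) :
    ⨆ c, (M.ρ (X.E 0 (h : P.g))).eigenspace c = ⊤ := by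
  rw [eq_top_iff, ← show (⨆ w, M.wtSp w) = ⊤ from hw]
  exact iSup_le fun w v hv =>
    Submodule.mem_iSup_of_mem (w.1 h) (Module.End.mem_eigenspace_iff.2 ((mem_wtSp.1 hv).1 h))

/-- if `𝔤_{0̄}` acts faithfully on a weight module, then `𝔥_{0̄}` acts semisimply on `𝔤_{0̄}`. -/
theorem adDiag_of_faithful (hw : M.IsWeight)
    (hinj : ∀ x ∈ P.gr 0, M.ρ (X.E 0 x) = 0 → x = 0) : C.AdDiag := by
  intro h
  set f := LieAlgebra.ad ℂ P.g (h : P.g) with hf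
  set A := M.ρ (X.E 0 (h : P.g)) with hA
  have hh := C.h0_le h.2
  have hfg : ∀ x ∈ P.gr 0, f x ∈ P.gr 0 := fun x hx => by simpa [hf] using lie_mem_gr hh hx
  have hfc : ∀ c : ℂ, ∀ x ∈ P.gr 0, (f - c • (1 : Module.End ℂ P.g)) x ∈ P.gr 0 := fun c x hx =>
    sub_mem (hfg x hx) (Submodule.smul_mem _ _ hx)
  have hfcp : ∀ (c : ℂ) (m : ℕ), ∀ x ∈ P.gr 0,
      ((f - c • (1 : Module.End ℂ P.g)) ^ m) x ∈ P.gr 0 := fun c m x hx => by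
    induction m with
    | zero => simpa using hx
    | succ m ih => rw [pow_succ', Module.End.mul_apply]; exact hfc c _ ih
  have hdiag := iSup_eigenspace_ρ hw h
  have hsq : ∀ c : ℂ, ∀ x ∈ P.gr 0, (f - c • (1 : Module.End ℂ P.g))
      ((f - c • (1 : Module.End ℂ P.g)) x) = 0 → (f - c • (1 : Module.End ℂ P.g)) x = 0 := by
    intro c x hx hx2
    set y := (f - c • (1 : Module.End ℂ P.g)) x with hy
    have hyx : ⁅(h : P.g), x⁆ = y + c • x := by simp [hy, hf]
    have hyy : ⁅(h : P.g), y⁆ = c • y := sub_eq_zero.1 (by simpa [hf] using hx2)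
    refine hinj y (hfc c x hx) (LinearMap.ext fun v => ?_)
    have hv : v ∈ ⨆ a, A.eigenspace a := hdiag ▸ Submodule.mem_top
    refine Submodule.iSup_induction _ (motive := fun v => M.ρ (X.E 0 y) v = 0) hv
      (fun a v hv => ?_) (map_zero _) (fun u v hu hv => by rw [map_add, hu, hv, add_zero])
    have hv := Module.End.mem_eigenspace_iff.1 hv
    have h1 : A (M.ρ (X.E 0 x) v) = (a + c) • M.ρ (X.E 0 x) v + M.ρ (X.E 0 y) v := by
      rw [hA, ρ_E_zero_apply hh hx, ← hA, hv, hyx]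
      simp only [map_add, map_smul, LinearMap.add_apply, LinearMap.smul_apply]
      module
    have h2 : A (M.ρ (X.E 0 y) v) = (a + c) • M.ρ (X.E 0 y) v := by
      rw [hA, ρ_E_zero_apply hh (show y ∈ P.gr 0 from hfc c x hx), ← hA, hv, hyy]
      simp only [map_smul, LinearMap.smul_apply, add_smul]
    have h3 : M.ρ (X.E 0 x) v ∈ A.maxGenEigenspace (a + c) := by
      rw [Module.End.mem_maxGenEigenspace]
      refine ⟨2, ?_⟩
      rw [pow_two, Module.End.mul_apply]
      simp [h1, h2]
    rw [maxGenEigenspace_eq_of_iSup_eigenspace hdiag, Module.End.mem_eigenspace_iff, h1] at h3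
    simpa using h3
  rw [Submodule.eq_iSup_inf_genEigenspace ⊤ hfg (Module.End.iSup_maxGenEigenspace_eq_top f)]
  refine iSup_mono fun c x hx => ?_
  obtain ⟨k, hk⟩ := (Module.End.mem_maxGenEigenspace f c x).1 hx.2
  have hdesc : ∀ k : ℕ, ((f - c • (1 : Module.End ℂ P.g)) ^ (k + 1)) x = 0 →
      (f - c • (1 : Module.End ℂ P.g)) x = 0 := by
    intro k
    induction k with
    | zero => simp
    | succ k ih =>
      intro hk
      refine ih ?_
      rw [pow_succ', pow_succ'] at hk
      rw [pow_succ']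
      exact hsq c _ (hfcp c k x hx.1) hk
  have := hdesc k (by rw [pow_succ', Module.End.mul_apply, hk, map_zero])
  exact Module.End.mem_eigenspace_iff.2 (sub_eq_zero.1 (by simpa using this))

/-- if some nonzero element of `𝔤_{0̄}` acts trivially, so do all real root vectors. -/
theorem ρ_E_eq_zero_of_not_faithful {x₀ : P.g} (hx₀ : x₀ ∈ P.gr 0) (h0 : x₀ ≠ 0)
    (hρ : M.ρ (X.E 0 x₀) = 0) {k : Fin P.n → ℤ} {α : Module.Dual ℂ C.h0} (hα : α ≠ 0) {x : P.g}
    (hx : x ∈ C.wtg k α) : M.ρ (X.E k x) = 0 := by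
  have hlie : ∀ {l} {x y : P.g}, x ∈ P.gr 0 → y ∈ P.gr l →
      M.ρ (X.E l ⁅x, y⁆) = M.ρ (X.E 0 x) * M.ρ (X.E l y) - M.ρ (X.E l y) * M.ρ (X.E 0 x) := by
    refine fun hx hy => LinearMap.ext fun v => ?_
    simp [ρ_E_zero_apply hx hy]
  let J : Submodule ℂ P.g := P.gr 0 ⊓ LinearMap.ker (M.ρ ∘ₗ X.E 0)
  have hJ : J = P.gr 0 := by
    refine (T.g0_ideals J inf_le_left fun x hx u hu => ⟨?_, ?_⟩).resolve_left fun h => h0 ?_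
    · simpa using lie_mem_gr hx hu.1
    · have h2 : M.ρ (X.E 0 u) = 0 := hu.2
      change M.ρ (X.E 0 ⁅x, u⁆) = 0
      rw [hlie hx hu.1, h2, mul_zero, zero_mul, sub_zero]
    · have : x₀ ∈ J := ⟨hx₀, hρ⟩
      simpa [h] using this
  obtain ⟨h, hh⟩ : ∃ h, α h ≠ 0 := by
    by_contra! H
    exact hα (LinearMap.ext H)
  have hhJ : (h : P.g) ∈ J := hJ ▸ C.h0_le h.2
  have hh0 : M.ρ (X.E 0 (h : P.g)) = 0 := hhJ.2
  have := hlie (C.h0_le h.2) hx.1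
  rw [mem_wtfull.1 hx.2, hh0, zero_mul, mul_zero, sub_zero, map_smul, map_smul] at this
  exact (smul_eq_zero.1 this).resolve_left hh

/-- the action on `V` of the `𝔰𝔩₂`-triple attached to a real root. -/
theorem nilpotentSl2_ρ (hint : M.Integrable) (hlz : M.LevelZero) {k : Fin P.n → ℤ}
    {α : Module.Dual ℂ C.h0} (hα : α ∈ C.Δen) {x y : P.g} (hx : x ∈ C.wtg k α)
    (hy : y ∈ C.wtg (-k) (-α)) (hxy : ⁅x, y⁆ = (T.coroot α : P.g)) :
    NilpotentSl2 (M.ρ (X.E k x)) (M.ρ (X.E (-k) y)) (M.ρ (X.E 0 (T.coroot α : P.g))) := by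
  have h2 := T.coroot_two α hα
  exact
  { he := fun v => by
      rw [ρ_E_zero_apply (C.h0_le (T.coroot α).2) hx.1, mem_wtfull.1 hx.2, h2]
      simp only [map_smul, LinearMap.smul_apply]
    hf := fun v => by
      rw [ρ_E_zero_apply (C.h0_le (T.coroot α).2) hy.1, mem_wtfull.1 hy.2, LinearMap.neg_apply, h2]
      simp only [neg_smul, map_neg, map_smul, LinearMap.neg_apply, LinearMap.smul_apply,
        sub_eq_add_neg]
    ef := fun v => by
      rw [ρ_lie_apply, X.br_EE k (-k) x y hx.1 hy.1, hxy, add_neg_cancel]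
      simp [hlz _]
    nil_e := fun _ v _ => hint.2 k α hα.1 x hx v
    nil_f := fun _ v _ => hint.2 (-k) (-α) (neg_ne_zero.2 hα.1) y hy v }

theorem exists_int_of_latSp_ne_bot (hint : M.Integrable) (hlz : M.LevelZero) (hd : C.AdDiag)
    {lam α : Module.Dual ℂ C.h0} (hα : α ∈ C.Δ0) {l : Fin P.n → ℤ}
    (hlam : M.latSp d₀ lam l ≠ ⊥) : ∃ z : ℤ, lam (T.coroot α) = z := by
  obtain ⟨v, hv, hv0⟩ := (Submodule.ne_bot_iff _).1 hlam
  obtain ⟨x, hx, y, hy, hxy⟩ := T.exists_sl2 hd (Δ0_sub hα) hα.2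
  exact (nilpotentSl2_ρ hint hlz (Δ0_sub hα) hx hy hxy).exists_int
    (((mem_latSp hlz).1 hv).1 _) hv0

/-- a finite-dimensional subspace is contained in a finite-dimensional subspace stable under
`𝔤_{0̄}`. -/
theorem exists_fg_wtg_invariant (hint : M.Integrable) {S : Submodule ℂ M.V} (hS : S.FG) :
    ∃ N : Submodule ℂ M.V, N.FG ∧ S ≤ N ∧
      ∀ β, ∀ x ∈ C.wtg 0 β, ∀ v ∈ N, M.ρ (X.E 0 x) v ∈ N := by
  let t : Set P.g := ⋃ β, (C.wtg 0 β : Set P.g)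
  obtain ⟨b, hbt, hspan, hli⟩ := exists_linearIndependent ℂ t
  have ht0 : Submodule.span ℂ t ≤ P.gr 0 :=
    Submodule.span_le.2 (Set.iUnion_subset fun β x hx => hx.1)
  have hmap : Submodule.span ℂ ((M.ρ ∘ₗ X.E 0) '' b) =
      (Submodule.span ℂ t).map (M.ρ ∘ₗ X.E 0) := by
    rw [← hspan, Submodule.map_span]
  have hlie : ∀ x ∈ Submodule.span ℂ t, ∀ y ∈ Submodule.span ℂ t,
      ⁅x, y⁆ ∈ Submodule.span ℂ t := by
    intro x hx y hy
    induction hx, hy using Submodule.span_induction₂ with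
    | mem_mem x y hx hy =>
      obtain ⟨β, hx⟩ := Set.mem_iUnion.1 hx
      obtain ⟨γ, hy⟩ := Set.mem_iUnion.1 hy
      refine Submodule.subset_span (Set.mem_iUnion.2 ⟨β + γ, ?_⟩)
      have := lie_mem_wtg hx hy
      rwa [add_zero] at this
    | zero_left y hy => simp
    | zero_right x hx => simp
    | add_left x y z _ _ _ h1 h2 => rw [add_lie]; exact add_mem h1 h2
    | add_right x y z _ _ _ h1 h2 => rw [lie_add]; exact add_mem h1 h2
    | smul_left r x y _ _ h => rw [smul_lie]; exact Submodule.smul_mem _ _ h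
    | smul_right r x y _ _ h => rw [lie_smul]; exact Submodule.smul_mem _ _ h
  have hlf : ∀ A ∈ (M.ρ ∘ₗ X.E 0) '' b, IsLocallyFinite A := by
    rintro _ ⟨x, hx, rfl⟩
    obtain ⟨β, hx⟩ := Set.mem_iUnion.1 (hbt hx)
    by_cases hβ : β = 0
    · subst hβ
      exact isLocallyFinite_of_iSup_eigenspace
        (iSup_eigenspace_ρ hint.1 ⟨x, mem_wtg_zero_iff.1 hx⟩)
    · exact isLocallyFinite_of_nilpotent (hint.2 0 β hβ x hx)
  have hcomm : ∀ A ∈ Submodule.span ℂ ((M.ρ ∘ₗ X.E 0) '' b),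
      ∀ B ∈ Submodule.span ℂ ((M.ρ ∘ₗ X.E 0) '' b),
        A * B - B * A ∈ Submodule.span ℂ ((M.ρ ∘ₗ X.E 0) '' b) := by
    rw [hmap]
    rintro _ ⟨x, hx, rfl⟩ _ ⟨y, hy, rfl⟩
    refine ⟨⁅x, y⁆, hlie x hx y hy, LinearMap.ext fun v => ?_⟩
    simp [ρ_E_zero_apply (ht0 hx) (ht0 hy)]
  obtain ⟨N, hN, hSN, hinv⟩ := exists_fg_invariant (hli.setFinite.image _) hlf hcomm hS
  refine ⟨N, hN, hSN, fun β x hx v hv => hinv _ ?_ v hv⟩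
  rw [hmap]
  exact ⟨x, Submodule.subset_span (Set.mem_iUnion.2 ⟨β, hx⟩), rfl⟩

/-- the weight vectors of `𝔥_{0̄}`-integral weight and fixed degree span a finite-dimensional
space. -/
theorem exists_fg_latSp_le (hint : M.Integrable) (hlz : M.LevelZero) (hfin : M.FinWt)
    (hd : C.AdDiag) (l : Fin P.n → ℤ) :
    ∃ N : Submodule ℂ M.V, N.FG ∧ ∀ lam, M.latSp d₀ lam l ≤ N := by
  let small : Set (Module.Dual ℂ C.h0) :=
    {lam | ∀ α ∈ C.Δ0, ∃ z : ℤ, |z| ≤ 1 ∧ lam (T.coroot α) = z}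
  have hsmall : small.Finite := by
    have : Finite C.Δ0 := finite_Δ0.to_subtype
    refine finite_of_separating (fun α : C.Δ0 => T.coroot (α : Module.Dual ℂ C.h0))
      (fun lam h => T.eq_zero_of_coroot_eq_zero hd fun α hα => h ⟨α, hα⟩) _ fun α => ?_
    refine ((Set.finite_Icc (-1 : ℤ) 1).image ((↑) : ℤ → ℂ)).subset ?_
    rintro _ ⟨lam, hlam, rfl⟩
    obtain ⟨z, hz, hz'⟩ := hlam α α.2
    exact ⟨z, abs_le.1 hz, hz'.symm⟩
  have hfg : (⨆ lam ∈ hsmall.toFinset, M.latSp d₀ lam l).FG :=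
    Submodule.fg_biSup _ _ fun lam _ => Module.Finite.iff_fg.1 (hfin _)
  obtain ⟨N, hN, hSN, hinv⟩ := exists_fg_wtg_invariant hint hfg
  refine ⟨N, hN, fun lam => ?_⟩
  by_cases hb : M.latSp d₀ lam l = ⊥
  · simp [hb]
  have hz := fun α hα => exists_int_of_latSp_ne_bot hint hlz hd (α := α) hα hb
  obtain ⟨n, hn⟩ := T.exists_nat_rootForm hz
  clear hb
  induction n using Nat.strong_induction_on generalizing lam with
  | _ n ih =>
  by_cases hs : lam ∈ small
  · exact (le_iSup₂_of_le lam (hsmall.mem_toFinset.2 hs) le_rfl).trans hSN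
  obtain ⟨α, hα, z, hz2, hαz⟩ : ∃ α ∈ C.Δ0, ∃ z : ℤ, 2 ≤ z ∧ lam (T.coroot α) = z := by
    simp only [small, Set.mem_ofPred_eq, not_forall, not_exists, not_and] at hs
    obtain ⟨α, hα, hs⟩ := hs
    obtain ⟨z, hαz⟩ := hz α hα
    have h1 : 1 < |z| := by
      by_contra h
      exact hs z (not_lt.1 h) hαz
    rcases lt_abs.1 h1 with h | h
    · exact ⟨α, hα, z, h, hαz⟩
    · refine ⟨-α, T.neg_mem_Δ0 hd hα, -z, h, ?_⟩
      rw [T.coroot_neg _ (Δ0_sub hα), map_neg, hαz, Int.cast_neg]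
  have hle : M.latSp d₀ (lam - α) l ≤ N := by
    obtain ⟨m, hm0, hm⟩ := T.rootForm_self_ne_zero hd hα
    have hz' : ∀ β ∈ C.Δ0, ∃ z : ℤ, (lam - α) (T.coroot β) = z := fun β hβ => by
      obtain ⟨z₁, h₁⟩ := hz β hβ
      obtain ⟨z₂, h₂, -⟩ := T.exists_int_coroot hd (Δ0_sub hβ) hβ.2 hα.2
      exact ⟨z₁ - z₂, by rw [LinearMap.sub_apply, h₁, h₂, Int.cast_sub]⟩
    obtain ⟨n', hn'⟩ := T.exists_nat_rootForm hz'
    refine ih n' ?_ (lam - α) hz' hn'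
    have := T.rootForm_sub hd hα lam
    rw [hn, hn', hm, hαz] at this
    have h : (n' : ℤ) = n - (z - 1) * m := by exact_mod_cast this
    have : 0 < (z - 1) * (m : ℤ) := mul_pos (by omega) (by omega)
    omega
  obtain ⟨x, hx, y, hy, hxy⟩ := T.exists_sl2 hd (Δ0_sub hα) hα.2
  have H := nilpotentSl2_ρ hint hlz (Δ0_sub hα) hx hy hxy
  have hf : ∀ v ∈ M.latSp d₀ lam l, M.ρ (X.E (-0) y) v ∈ M.latSp d₀ (lam - α) l := fun v hv => by
    simpa [sub_eq_add_neg] using ρ_E_mem_latSp hlz hy hv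
  have he : ∀ v ∈ M.latSp d₀ (lam - α) l, M.ρ (X.E 0 x) v ∈ M.latSp d₀ lam l := fun v hv => by
    simpa using ρ_E_mem_latSp hlz hx hv
  let F : Module.End ℂ (M.latSp d₀ lam l) :=
    (M.ρ (X.E 0 x) * M.ρ (X.E (-0) y)).restrict fun v hv => he _ (hf v hv)
  have : FiniteDimensional ℂ (M.latSp d₀ lam l) := hfin _
  have hFinj : Function.Injective F := by
    refine (injective_iff_map_eq_zero F).2 fun v hv => ?_
    by_contra hv0
    refine H.e_f_apply_ne_zero (m := z.toNat) (by omega) (v := (v : M.V)) ?_ (by simpa using hv0)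
      (congrArg Subtype.val hv)
    rw [((mem_latSp hlz).1 v.2).1, hαz]
    congr 1
    exact_mod_cast (Int.toNat_of_nonneg (by omega)).symm
  intro v hv
  obtain ⟨u, hu⟩ := (LinearMap.injective_iff_surjective.1 hFinj) ⟨v, hv⟩
  have : M.ρ (X.E 0 x) (M.ρ (X.E (-0) y) u) = v := congrArg Subtype.val hu
  rw [← this]
  exact hinv α x hx _ (hle (hf _ u.2))

theorem exists_bound_of_degree (hint : M.Integrable) (hlz : M.LevelZero) (hfin : M.FinWt)
    (hd : C.AdDiag) (α : Module.Dual ℂ C.h0) (l : Fin P.n → ℤ) :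
    ∃ B : ℕ, ∀ (m : ℕ) (lam : Module.Dual ℂ C.h0), lam (T.coroot α) = m →
      M.latSp d₀ lam l ≠ ⊥ → m ≤ B := by
  obtain ⟨N, hN, hle⟩ := exists_fg_latSp_le (d₀ := d₀) hint hlz hfin hd l
  obtain ⟨N, hN, hle', hinv⟩ := exists_fg_wtg_invariant hint hN
  have : FiniteDimensional ℂ N := Module.Finite.iff_fg.2 hN
  let F : Module.End ℂ N := (M.ρ (X.E 0 (T.coroot α : P.g))).restrict
    (hinv 0 _ (mem_wtg_zero_iff.2 (T.coroot α).2))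
  have hfinite := Set.Finite.preimage (f := ((↑) : ℕ → ℂ)) Nat.cast_injective.injOn
    F.finite_hasEigenvalue
  obtain ⟨B, hB⟩ := hfinite.bddAbove
  refine ⟨B, fun m lam hm hlam => hB ?_⟩
  obtain ⟨v, hv, hv0⟩ := (Submodule.ne_bot_iff _).1 hlam
  refine Module.End.hasEigenvalue_of_hasEigenvector (x := ⟨v, hle' (hle lam hv)⟩)
    ⟨Module.End.mem_eigenspace_iff.2 (Subtype.ext ?_), by simpa using hv0⟩
  change M.ρ (X.E 0 (T.coroot α : P.g)) v = (m : ℂ) • v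
  rw [((mem_latSp hlz).1 hv).1, hm]

theorem exists_bound (hint : M.Integrable) (hlz : M.LevelZero) (hfin : M.FinWt)
    (hd : C.AdDiag) {α : Module.Dual ℂ C.h0} (hα : α ∈ C.Δ0) :
    ∃ B : ℕ, ∀ (m : ℕ) (l : Fin P.n → ℤ) (lam : Module.Dual ℂ C.h0), lam (T.coroot α) = m →
      M.latSp d₀ lam l ≠ ⊥ → m ≤ B := by
  let S : Set (ℕ × (Fin P.n → ℤ)) :=
    {p | ∃ lam : Module.Dual ℂ C.h0, lam (T.coroot α) = p.1 ∧ M.latSp d₀ lam p.2 ≠ ⊥}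
  have h2 := T.coroot_two α (Δ0_sub hα)
  have hM : 0 < ∏ i, P.m i := Finset.prod_pos fun i _ => P.mpos i
  have key : ∀ (m : ℕ) (lam : Module.Dual ℂ C.h0) (l r : Fin P.n → ℤ), P.inΓ r →
      lam (T.coroot α) = m → M.latSp d₀ lam l ≠ ⊥ →
      ∃ v ∈ M.latSp d₀ (lam - m • α) (l + m • r), v ≠ 0 := by
    intro m lam l r hr hm hlam
    obtain ⟨v, hv, hv0⟩ := (Submodule.ne_bot_iff _).1 hlam
    have hk : C.wtg (-r) α ≠ ⊥ := by
      rw [wtg_eq_of_inΓ (k := 0) (l := -r) (fun i => by simpa using hr i)]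
      exact hα.2
    obtain ⟨x, hx, y, hy, hxy⟩ := T.exists_sl2 hd (Δ0_sub hα) hk
    have H := nilpotentSl2_ρ hint hlz (Δ0_sub hα) hx hy hxy
    refine ⟨_, ?_, H.f_pow_ne_zero (m := m) (by rw [((mem_latSp hlz).1 hv).1, hm]) hv0⟩
    convert! ρ_E_pow_mem_latSp hlz hy hv m using 2
    · rw [smul_neg, sub_eq_add_neg]
    · rw [neg_neg]
  obtain ⟨x, hx, y, hy, hxy⟩ := T.exists_sl2 hd (Δ0_sub hα) hα.2
  have H := nilpotentSl2_ρ hint hlz (Δ0_sub hα) hx hy hxy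
  suffices h : ∃ B, ∀ m l, (m, l) ∈ S → m ≤ B from
    h.imp fun B hB m l lam hm hlam => hB m l ⟨lam, hm, hlam⟩
  refine exists_bound_of_translation hM ?_ ?_ ?_
  · rintro m l ⟨lam, hm, hlam⟩
    simp only at hm hlam
    obtain ⟨v, hv, hv0⟩ := (Submodule.ne_bot_iff _).1 hlam
    have hne := H.f_pow_ne_zero (m := m + 2) (by rw [((mem_latSp hlz).1 hv).1, hm]) hv0
    rw [pow_succ, Module.End.mul_apply] at hne
    refine ⟨lam - α, ?_, (Submodule.ne_bot_iff _).2
      ⟨M.ρ (X.E (-0) y) v, ?_, fun h => hne (by rw [h, map_zero])⟩⟩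
    · rw [LinearMap.sub_apply, hm, h2]
      push_cast
      ring
    · simpa [sub_eq_add_neg] using ρ_E_mem_latSp hlz hy hv
  · rintro m l s ⟨lam, hm, hlam⟩
    simp only at hm hlam
    obtain ⟨v, hv, hv0⟩ := key m lam l (fun i => ((∏ i, P.m i : ℕ) : ℤ) * s i)
      (fun i => Dvd.dvd.mul_right
        (Int.natCast_dvd_natCast.2 (Finset.dvd_prod_of_mem _ (Finset.mem_univ i))) _) hm hlam
    have hne := H.swap.f_pow_ne_zero (m := m) (v := v) (by
      rw [LinearMap.neg_apply, ((mem_latSp hlz).1 hv).1, LinearMap.sub_apply,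
        LinearMap.smul_apply, hm, h2, ← neg_smul]
      congr 1
      simp only [nsmul_eq_mul]
      ring) hv0
    refine ⟨lam, hm, (Submodule.ne_bot_iff _).2 ⟨_, ?_, hne⟩⟩
    convert! ρ_E_pow_mem_latSp hlz hx hv m using 2
    · rw [sub_add_cancel]
    · ext i
      simp
      ring
  · intro l
    obtain ⟨B, hB⟩ := exists_bound_of_degree (d₀ := d₀) hint hlz hfin hd α l
    exact ⟨B, fun m ⟨lam, hm, hlam⟩ => hB m lam hm hlam⟩

/-- only finitely many weights of `𝔥_{0̄}` occur. -/
theorem finite_weights (hint : M.Integrable) (hlz : M.LevelZero) (hfin : M.FinWt)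
    (hd : C.AdDiag) : {lam | ∃ l, M.latSp d₀ lam l ≠ ⊥}.Finite := by
  have : Finite C.Δ0 := finite_Δ0.to_subtype
  refine finite_of_separating (fun α : C.Δ0 => T.coroot (α : Module.Dual ℂ C.h0))
    (fun lam h => T.eq_zero_of_coroot_eq_zero hd fun α hα => h ⟨α, hα⟩) _ fun ⟨α, hα⟩ => ?_
  obtain ⟨B₁, h₁⟩ := exists_bound (d₀ := d₀) hint hlz hfin hd hα
  obtain ⟨B₂, h₂⟩ := exists_bound (d₀ := d₀) hint hlz hfin hd (T.neg_mem_Δ0 hd hα)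
  refine ((Set.finite_Icc (-B₂ : ℤ) B₁).image ((↑) : ℤ → ℂ)).subset ?_
  rintro _ ⟨lam, ⟨l, hlam⟩, rfl⟩
  obtain ⟨z, hz⟩ := exists_int_of_latSp_ne_bot hint hlz hd hα hlam
  refine ⟨z, ⟨?_, ?_⟩, hz.symm⟩
  · by_contra! h
    have := h₂ (-z).toNat l lam (by
      rw [T.coroot_neg _ (Δ0_sub hα), map_neg, hz]
      exact_mod_cast (Int.toNat_of_nonneg (a := -z) (by omega)).symm) hlam
    omega
  · by_contra! h
    have := h₁ z.toNat l lam (by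
      rw [hz]
      exact_mod_cast (Int.toNat_of_nonneg (a := z) (by omega)).symm) hlam
    omega

theorem mem_Vplus {v : M.V} : v ∈ M.Vplus ↔
    ∀ α ∈ T.pos, ∀ k, ∀ x ∈ C.wtg k α, M.ρ (X.E k x) v = 0 := by
  simp only [Vplus, Toroidal.tauP, Submodule.mem_iInf, LinearMap.mem_ker, Set.mem_ofPred_eq]
  exact ⟨fun h α hα k x hx => h _ ⟨α, hα, k, x, hx, rfl⟩,
    fun h t ⟨α, hα, k, x, hx, ht⟩ => ht ▸ h α hα k x hx⟩

theorem exists_latSp_ne_bot [Nontrivial M.V] (hw : M.IsWeight) (hlz : M.LevelZero) :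
    ∃ d₀ lam, M.latSp d₀ lam 0 ≠ ⊥ := by
  by_contra! H
  refine bot_ne_top (α := Submodule ℂ M.V) ?_
  rw [← show (⨆ w, M.wtSp w) = ⊤ from hw, eq_comm, eq_bot_iff]
  refine iSup_le fun w v hv => ?_
  rw [← H w.2.2 w.1, mem_latSp hlz]
  obtain ⟨h1, -, h2⟩ := mem_wtSp.1 hv
  exact ⟨h1, by simpa using h2⟩

theorem Vplus_ne_bot_of_adDiag [Nontrivial M.V] (hint : M.Integrable) (hlz : M.LevelZero)
    (hfin : M.FinWt) (hd : C.AdDiag) : M.Vplus ≠ ⊥ := by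
  obtain ⟨d₀, lam₀, h₀⟩ := exists_latSp_ne_bot (M := M) hint.1 hlz
  have hF := finite_weights (d₀ := d₀) hint hlz hfin hd
  set F := {lam | ∃ l, M.latSp d₀ lam l ≠ ⊥} with hFdef
  have : Finite F := hF.to_subtype
  let r : F → F → Prop := fun a b => ∃ L : List (Module.Dual ℂ C.h0), L ≠ [] ∧
    (∀ α ∈ L, α ∈ T.pos) ∧ (a : Module.Dual ℂ C.h0) = b + L.sum
  have : IsTrans F r := ⟨by
    rintro a b c ⟨L, hL, hLp, hab⟩ ⟨L', -, hLp', hbc⟩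
    refine ⟨L' ++ L, by simp [hL], fun α hα => ?_, by rw [hab, hbc, List.sum_append, add_assoc]⟩
    exact (List.mem_append.1 hα).elim (hLp' α) (hLp α)⟩
  have : Std.Irrefl r := ⟨fun a ⟨L, hL, hLp, ha⟩ =>
    T.sum_pos_ne_zero hd L hL hLp (by simpa using ha)⟩
  obtain ⟨⟨lam, l, hlam⟩, -, hmax⟩ := (Finite.wellFounded_of_trans_of_irrefl r).has_min Set.univ
    ⟨⟨lam₀, 0, h₀⟩, trivial⟩
  obtain ⟨v, hv, hv0⟩ := (Submodule.ne_bot_iff _).1 hlam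
  refine (Submodule.ne_bot_iff _).2 ⟨v, mem_Vplus.2 fun α hα k x hx => ?_, hv0⟩
  by_contra hne
  refine hmax ⟨lam + α, l + k, (Submodule.ne_bot_iff _).2 ⟨_, ρ_E_mem_latSp hlz hx hv, hne⟩⟩ trivial
    ⟨[α], by simp, by simpa using hα, by simp⟩

end TRep

section Statements

variable {P : PreT} {C : Cartan P} {T : Torus P C} {X : Toroidal P C T}

/-- Proposition 3.4: the highest weight space of an irreducible integrable
level zero `τ̃`-module with finite-dimensional weight spaces is non-zero. -/
theorem statement1 (M : TRep X) (hirr : M.Irr) (hint : M.Integrable)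
    (hlz : M.LevelZero) (hfin : M.FinWt) : M.Vplus ≠ ⊥ := by
  have := hirr.1
  by_cases hinj : ∀ x ∈ P.gr 0, M.ρ (X.E 0 x) = 0 → x = 0
  · exact TRep.Vplus_ne_bot_of_adDiag hint hlz hfin (TRep.adDiag_of_faithful hint.1 hinj)
  · push Not at hinj
    obtain ⟨x₀, hx₀, hρ, h0⟩ := hinj
    obtain ⟨v, hv⟩ := exists_ne (0 : M.V)
    refine (Submodule.ne_bot_iff _).2 ⟨v, TRep.mem_Vplus.2 fun α hα k x hx => ?_, hv⟩
    rw [TRep.ρ_E_eq_zero_of_not_faithful hx₀ h0 hρ (T.pos_sub hα).1 hx, LinearMap.zero_apply]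

end Statements
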